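/- arXiv:2102.05168 — 4 statements merged into one kernel-verified Lean document; each statement's English description precedes it below -/
import Mathlib

section
/- There is a universal constant c > 0 such that for every finite metric (V,d) on n ≥ 2 points with all distances at least 1 and every probability distribution (p_v)_{v∈V} on V, there exists a hierarchical decomposition H of (V,d) in which at least a 0.95 fraction of nodes by weight are (c/log n)-padded, i.e., Σ_{v ∈ V, v is (c/log n)-padded in H} p_v ≥ 0.95. -/
/-- A hierarchical decomposition of the metric `(V, d)`. -/
structure HierDecomp (V : Type*) (d : V → V → ℝ) where
  h : ℕ
  P : ℕ → Set (Set V)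
  partition : ∀ i ≤ h, Setoid.IsPartition (P i)
  top : P h = {Set.univ}
  part_diam : ∀ i ≤ h, ∀ p ∈ P i, ∀ u ∈ p, ∀ v ∈ p, d u v ≤ 2 ^ i
  refines : ∀ i < h, ∀ p ∈ P i, ∃ q ∈ P (i + 1), p ⊆ q
  metric_diam : ∀ u v : V, d u v ≤ 2 ^ h

/-- A node `v` is `α`-padded in the hierarchical decomposition `H` if for every level `i`
the ball `B(v, α·2^i)` is contained in a single part of `P i`. -/
def HierDecomp.Padded {V : Type*} {d : V → V → ℝ} (H : HierDecomp V d) (α : ℝ)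
    (v : V) : Prop :=
  ∀ i ≤ H.h, ∃ p ∈ H.P i, {u : V | d v u ≤ α * 2 ^ i} ⊆ p

open Classical in
/-- The closed ball of radius `r` around `v`, as a finset. -/
noncomputable def finBall {V : Type*} [Fintype V] (d : V → V → ℝ) (v : V) (r : ℝ) : Finset V :=
  Finset.univ.filter fun u => d v u ≤ r

theorem mem_finBall {V : Type*} [Fintype V] {d : V → V → ℝ} {v u : V} {r : ℝ} :
    u ∈ finBall d v r ↔ d v u ≤ r := by
  simp [finBall]

theorem finBall_mono {V : Type*} [Fintype V] (d : V → V → ℝ) (v : V) {r s : ℝ} (h : r ≤ s) :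
    finBall d v r ⊆ finBall d v s := fun _ hu =>
  mem_finBall.2 ((mem_finBall.1 hu).trans h)

open Classical in
/-- In a uniformly random enumeration, each element of `S` is the first one of `S` with
probability `1 / #S`. -/
theorem card_mul_card_first {V : Type*} [Fintype V] (S : Finset V) {w : V} (hw : w ∈ S) :
    S.card * (Finset.univ.filter fun e : V ≃ Fin (Fintype.card V) =>
      ∀ u ∈ S, e w ≤ e u).card = Fintype.card (V ≃ Fin (Fintype.card V)) := by
  have hsymm : ∀ x ∈ S, (Finset.univ.filter fun e : V ≃ Fin (Fintype.card V) =>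
      ∀ u ∈ S, e x ≤ e u).card = (Finset.univ.filter fun e : V ≃ Fin (Fintype.card V) =>
      ∀ u ∈ S, e w ≤ e u).card := by
    intro x hx
    have hS : ∀ u ∈ S, Equiv.swap x w u ∈ S := by
      intro u hu
      rw [Equiv.swap_apply_def]
      split_ifs <;> assumption
    refine Finset.card_bij' (fun e _ => (Equiv.swap x w).trans e)
      (fun e _ => (Equiv.swap x w).trans e) ?_ ?_ ?_ ?_
    · intro e he
      simp only [Finset.mem_filter, Finset.mem_univ, true_and, Equiv.trans_apply,
        Equiv.swap_apply_right] at he ⊢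
      exact fun u hu => he _ (hS u hu)
    · intro e he
      simp only [Finset.mem_filter, Finset.mem_univ, true_and, Equiv.trans_apply,
        Equiv.swap_apply_left] at he ⊢
      exact fun u hu => he _ (hS u hu)
    · intro e _
      ext u
      simp
    · intro e _
      ext u
      simp
  have hpart : (Finset.univ : Finset (V ≃ Fin (Fintype.card V))) =
      S.biUnion fun x => Finset.univ.filter fun e : V ≃ Fin (Fintype.card V) =>
        ∀ u ∈ S, e x ≤ e u := by
    ext e
    obtain ⟨x, hx, hmin⟩ := S.exists_min_image e ⟨w, hw⟩
    simp only [Finset.mem_univ, Finset.mem_biUnion, Finset.mem_filter, true_and, true_iff]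
    exact ⟨x, hx, hmin⟩
  have hcard := congrArg Finset.card hpart
  rw [Finset.card_biUnion, Finset.sum_congr rfl hsymm, Finset.sum_const, smul_eq_mul,
    Finset.card_univ] at hcard
  · exact hcard.symm
  · intro x hx y hy hxy
    rw [Function.onFun, Finset.disjoint_left]
    intro e hex hey
    simp only [Finset.mem_filter, Finset.mem_univ, true_and] at hex hey
    exact hxy (e.injective (le_antisymm (hex y hy) (hey x hx)))

open Classical in
/-- In a uniformly random enumeration, the first element of `S` lies outside `T ⊆ S` with
probability at most `log (#S / #T)`. -/
theorem card_first_notMem_le {V : Type*} [Fintype V] {S T : Finset V} (hTS : T ⊆ S)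
    (hT : T.Nonempty) :
    ((Finset.univ.filter fun e : V ≃ Fin (Fintype.card V) =>
      ∃ w ∈ S \ T, ∀ u ∈ S, e w ≤ e u).card : ℝ) ≤
      Fintype.card (V ≃ Fin (Fintype.card V)) * (Real.log S.card - Real.log T.card) := by
  set N : ℝ := ((Fintype.card (V ≃ Fin (Fintype.card V)) : ℕ) : ℝ) with hN
  have hTpos : (0 : ℝ) < T.card := by exact_mod_cast hT.card_pos
  have hSpos : (0 : ℝ) < S.card := by exact_mod_cast (hT.mono hTS).card_pos
  have hunion : (Finset.univ.filter fun e : V ≃ Fin (Fintype.card V) =>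
      ∃ w ∈ S \ T, ∀ u ∈ S, e w ≤ e u) ⊆ (S \ T).biUnion fun w =>
        Finset.univ.filter fun e : V ≃ Fin (Fintype.card V) => ∀ u ∈ S, e w ≤ e u := by
    intro e he
    simpa only [Finset.mem_filter, Finset.mem_univ, true_and, Finset.mem_biUnion] using he
  have hcard : ((Finset.univ.filter fun e : V ≃ Fin (Fintype.card V) =>
      ∃ w ∈ S \ T, ∀ u ∈ S, e w ≤ e u).card : ℝ) ≤ ∑ w ∈ S \ T,
        ((Finset.univ.filter fun e : V ≃ Fin (Fintype.card V) =>
          ∀ u ∈ S, e w ≤ e u).card : ℝ) := by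
    exact_mod_cast (Finset.card_le_card hunion).trans Finset.card_biUnion_le
  have hterm : ∀ w ∈ S \ T, ((Finset.univ.filter fun e : V ≃ Fin (Fintype.card V) =>
      ∀ u ∈ S, e w ≤ e u).card : ℝ) = N / S.card := by
    intro w hw
    rw [eq_div_iff hSpos.ne', mul_comm, hN]
    exact_mod_cast card_mul_card_first S (Finset.mem_sdiff.1 hw).1
  rw [Finset.sum_congr rfl hterm, Finset.sum_const, nsmul_eq_mul,
    Finset.cast_card_sdiff hTS] at hcard
  refine hcard.trans ?_
  have hlog := Real.one_sub_inv_le_log_of_pos (div_pos hSpos hTpos)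
  rw [Real.log_div hSpos.ne' hTpos.ne', inv_div] at hlog
  calc ((S.card : ℝ) - T.card) * (N / S.card) = N * (1 - T.card / S.card) := by
        field_simp
    _ ≤ _ := mul_le_mul_of_nonneg_left hlog (by positivity)

/-- Assign each point to the first point, in the enumeration `e`, within distance `r`. If the
first point within distance `r + t` of `v` is within distance `r - t`, then all points within
distance `t` of `v` are assigned to the same point. -/
theorem exists_first_assignment {V : Type*} [Fintype V] {d : V → V → ℝ}
    (symm : ∀ u v, d u v = d v u) (tri : ∀ u v x, d u x ≤ d u v + d v x)
    (self : ∀ v, d v v = 0) {n : ℕ} (e : V ≃ Fin n) {r : ℝ} (hr : 0 ≤ r) :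
    ∃ f : V → V, (∀ u, d u (f u) ≤ r) ∧ ∀ v t,
      (∀ w, d v w ≤ r + t → (∀ u, d v u ≤ r + t → e w ≤ e u) → d v w ≤ r - t) →
      ∀ u, d v u ≤ t → f u = f v := by
  have hex : ∀ u, ∃ w, d u w ≤ r ∧ ∀ x, d u x ≤ r → e w ≤ e x := by
    intro u
    obtain ⟨w, hw, hmin⟩ := (finBall d u r).exists_min_image e
      ⟨u, mem_finBall.2 (by rw [self]; exact hr)⟩
    exact ⟨w, mem_finBall.1 hw, fun x hx => hmin x (mem_finBall.2 hx)⟩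
  choose f hf hmin using hex
  refine ⟨f, hf, fun v t hv u hu => ?_⟩
  have ht : 0 ≤ t := by
    have h1 := tri v u v
    rw [self, symm u v] at h1
    linarith
  obtain ⟨w, hw, hwmin⟩ := (finBall d v (r + t)).exists_min_image e
    ⟨v, mem_finBall.2 (by rw [self]; linarith)⟩
  rw [mem_finBall] at hw
  have hwr := hv w hw fun x hx => hwmin x (mem_finBall.2 hx)
  have key : ∀ x, d v x ≤ t → f x = w := by
    intro x hx
    apply e.injective
    apply le_antisymm
    · apply hmin
      have := tri x v w
      rw [symm x v] at this
      linarith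
    · apply hwmin
      rw [mem_finBall]
      linarith [tri v x (f x), hf x]
  rw [key u hu, key v (by rw [self]; exact ht)]

open Classical in
/-- A partition at a single scale, in which the weight of the points whose `t`-ball is cut is
controlled by the local growth of the metric. -/
theorem exists_assignment_weight_cut_le {V : Type*} [Fintype V] {d : V → V → ℝ}
    (symm : ∀ u v, d u v = d v u) (tri : ∀ u v x, d u x ≤ d u v + d v x)
    (self : ∀ v, d v v = 0) {p : V → ℝ} (hp : ∀ v, 0 ≤ p v) {k : ℕ} (hk : 0 < k)
    {r t : ℝ} (hr : 0 ≤ r) (ht : 0 ≤ t) :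
    ∃ f : V → V, (∀ u, d u (f u) ≤ r + 2 * k * t) ∧
      k * ∑ v, p v * (if ∀ u, d v u ≤ t → f u = f v then 0 else 1) ≤
        ∑ v, p v * (Real.log (finBall d v (r + 2 * k * t)).card -
          Real.log (finBall d v r).card) := by
  let ρ : ℕ → ℝ := fun j => r + 2 * j * t
  have hρ : ∀ j, 0 ≤ ρ j + t := fun j => by positivity
  choose f hf hcut using fun (e : V ≃ Fin (Fintype.card V)) (j : ℕ) =>
    exists_first_assignment symm tri self e (hρ j)
  let Ω : Finset ((V ≃ Fin (Fintype.card V)) × ℕ) := Finset.univ ×ˢ Finset.range k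
  have hΩ : Ω.Nonempty :=
    Finset.Nonempty.product ⟨Fintype.equivFin V, Finset.mem_univ _⟩
      ⟨0, Finset.mem_range.2 hk⟩
  set N : ℝ := ((Fintype.card (V ≃ Fin (Fintype.card V)) : ℕ) : ℝ) with hN
  have hNpos : 0 < N := by
    have : Nonempty (V ≃ Fin (Fintype.card V)) := ⟨Fintype.equivFin V⟩
    rw [hN]
    exact_mod_cast Fintype.card_pos
  let A : ℝ := ∑ v, p v * (Real.log (finBall d v (r + 2 * k * t)).card -
          Real.log (finBall d v r).card)
  have hpoint : ∀ v, ∑ x ∈ Ω, (if ∀ u, d v u ≤ t → f x.1 x.2 u = f x.1 x.2 v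
      then (0 : ℝ) else 1) ≤ N * (Real.log (finBall d v (r + 2 * k * t)).card -
          Real.log (finBall d v r).card) := by
    intro v
    rw [Finset.sum_product_right]
    have hj : ∀ j ∈ Finset.range k, ∑ e, (if ∀ u, d v u ≤ t → f e j u = f e j v
        then (0 : ℝ) else 1) ≤ N * (Real.log (finBall d v (ρ (j + 1))).card -
          Real.log (finBall d v (ρ j)).card) := by
      intro j _
      have hstep : ρ (j + 1) = ρ j + t + t := by
        simp only [ρ]
        push_cast
        ring
      refine le_trans ?_ (card_first_notMem_le (finBall_mono d v (by linarith))
        ⟨v, mem_finBall.2 (by rw [self]; simp only [ρ]; positivity)⟩)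
      rw [← Finset.sum_boole]
      refine Finset.sum_le_sum fun e _ => ?_
      by_cases hgood : ∀ u, d v u ≤ t → f e j u = f e j v
      · rw [if_pos hgood]
        split_ifs <;> norm_num
      · rw [if_neg hgood, if_pos]
        by_contra hno
        refine hgood (hcut e j v t fun w hw hmin => ?_)
        by_contra hfar
        refine hno ⟨w, ?_, fun u hu => hmin u ?_⟩
        · rw [Finset.mem_sdiff, mem_finBall, mem_finBall, hstep]
          exact ⟨hw, fun h => hfar (by linarith)⟩
        · rwa [mem_finBall, hstep] at hu
    refine (Finset.sum_le_sum hj).trans (le_of_eq ?_)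
    rw [← Finset.mul_sum,
      Finset.sum_range_sub (fun j => Real.log (finBall d v (ρ j)).card) k]
    simp [ρ]
  obtain ⟨x, hx, hxle⟩ : ∃ x ∈ Ω, k * ∑ v, p v * (if ∀ u, d v u ≤ t →
      f x.1 x.2 u = f x.1 x.2 v then (0 : ℝ) else 1) ≤ A := by
    refine Finset.exists_le_of_sum_le hΩ ?_
    rw [← Finset.mul_sum, Finset.sum_comm, Finset.sum_const, nsmul_eq_mul]
    have hcard : (Ω.card : ℝ) = N * k := by
      simp [Ω, hN, Finset.card_product]
    rw [hcard, mul_comm N, mul_assoc]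
    refine mul_le_mul_of_nonneg_left ?_ (Nat.cast_nonneg k)
    simp only [A]
    rw [Finset.mul_sum]
    refine Finset.sum_le_sum fun v _ => ?_
    rw [← Finset.mul_sum, mul_left_comm]
    exact mul_le_mul_of_nonneg_left (hpoint v) (hp v)
  refine ⟨f x.1 x.2, fun u => (hf x.1 x.2 u).trans ?_, hxle⟩
  have hlt : x.2 + 1 ≤ k := Finset.mem_range.1 (Finset.mem_product.1 hx).2
  have hlt' : (x.2 : ℝ) + 1 ≤ k := by exact_mod_cast hlt
  simp only [ρ]
  nlinarith

/-- The equivalence relation identifying points that all `f j` with `i ≤ j < h` identify. -/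
def commonKer {V : Type*} (f : ℕ → V → V) (h i : ℕ) : Setoid V where
  r u v := ∀ j, i ≤ j → j < h → f j u = f j v
  iseqv := ⟨fun _ _ _ _ => rfl, fun H j hi hj => (H j hi hj).symm,
    fun H H' j hi hj => (H j hi hj).trans (H' j hi hj)⟩

/-- The hierarchical decomposition obtained from assignments of points to centers at each
scale, by taking common refinements from the top. -/
def HierDecomp.ofAssignments {V : Type*} [Nonempty V] {d : V → V → ℝ}
    (symm : ∀ u v, d u v = d v u) (tri : ∀ u v x, d u x ≤ d u v + d v x) (h : ℕ)
    (hdiam : ∀ u v, d u v ≤ 2 ^ h) (f : ℕ → V → V)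
    (hf : ∀ i u, d u (f i u) ≤ 2 ^ i / 2) : HierDecomp V d where
  h := h
  P i := (commonKer f h i).classes
  partition i _ := Setoid.isPartition_classes _
  top := by
    have hrel : ∀ y, {x | commonKer f h h x y} = Set.univ := fun y =>
      Set.eq_univ_of_forall fun x j hi hj => absurd hj hi.not_gt
    ext s
    simp only [Setoid.classes, Set.mem_ofPred_eq, hrel, Set.mem_singleton_iff, exists_const]
  part_diam i hi s hs u hu v hv := by
    obtain hlt | rfl := hi.lt_or_eq
    · obtain ⟨y, rfl⟩ := hs
      have h1 : f i u = f i y := hu i le_rfl hlt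
      have h2 : f i v = f i y := hv i le_rfl hlt
      have h3 := hf i u
      have h4 := hf i v
      rw [h1] at h3
      rw [h2, symm] at h4
      linarith [tri u (f i y) v]
    · exact hdiam u v
  refines i _ s hs := by
    obtain ⟨y, rfl⟩ := hs
    exact ⟨_, ⟨y, rfl⟩, fun x hx j hij hj => hx j (Nat.le_of_succ_le hij) hj⟩
  metric_diam := hdiam

theorem HierDecomp.padded_ofAssignments {V : Type*} [Nonempty V] {d : V → V → ℝ}
    (symm : ∀ u v, d u v = d v u) (tri : ∀ u v x, d u x ≤ d u v + d v x) (h : ℕ)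
    (hdiam : ∀ u v, d u v ≤ 2 ^ h) (f : ℕ → V → V)
    (hf : ∀ i u, d u (f i u) ≤ 2 ^ i / 2) {α : ℝ} (hα : 0 ≤ α) {v : V}
    (hv : ∀ i < h, ∀ u, d v u ≤ α * 2 ^ i → f i u = f i v) :
    (HierDecomp.ofAssignments symm tri h hdiam f hf).Padded α v := by
  intro i _
  refine ⟨_, ⟨v, rfl⟩, fun u hu j hij hj => hv j hj u (le_trans hu ?_)⟩
  exact mul_le_mul_of_nonneg_left (pow_le_pow_right₀ one_le_two hij) hα

/-- There is a universal constant `c > 0` such that for every finite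
metric on `n ≥ 2` points with all distances at least `1` and every probability
distribution `p` on the points, there is a hierarchical decomposition in which at least a
`0.95` fraction of nodes by weight are `(c/log n)`-padded. -/
theorem exists_hierDecomp_weighted_padded :
    ∃ c : ℝ, 0 < c ∧
      ∀ (V : Type) [Fintype V], ∀ d : V → V → ℝ,
        2 ≤ Fintype.card V →
        (∀ u v : V, d u v = d v u) →
        (∀ u v x : V, d u x ≤ d u v + d v x) →
        (∀ u v : V, d u v = 0 ↔ u = v) →
        (∀ u v : V, u ≠ v → 1 ≤ d u v) →
        ∀ p : V → ℝ, (∀ v, 0 ≤ p v) → ∑ v : V, p v = 1 →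
        ∃ H : HierDecomp V d,
          (0.95 : ℝ) ≤ ∑ v : V,
            Set.indicator {u : V | H.Padded (c / Real.log (Fintype.card V : ℝ)) u} p v := by
  classical
  refine ⟨1 / 200, by norm_num, ?_⟩
  intro V _ d hcard symm tri hzero _ p hp hsum
  have self : ∀ v, d v v = 0 := fun v => (hzero v v).2 rfl
  have : Nonempty V := Fintype.card_pos_iff.1 (by omega)
  obtain ⟨h, hdiam⟩ : ∃ h : ℕ, ∀ u v, d u v ≤ 2 ^ h := by
    obtain ⟨M, hM⟩ := (Set.finite_range fun x : V × V => d x.1 x.2).bddAbove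
    obtain ⟨h, hh⟩ := pow_unbounded_of_one_lt M (one_lt_two : (1 : ℝ) < 2)
    exact ⟨h, fun u v => (hM ⟨(u, v), rfl⟩).trans hh.le⟩
  set L : ℝ := Real.log (Fintype.card V : ℝ) with hL
  have hLlow : 0.69 ≤ L := by
    have h1 : Real.log 2 ≤ L := Real.log_le_log (by norm_num) (by exact_mod_cast hcard)
    linarith [Real.log_two_gt_d9]
  obtain ⟨k, hk⟩ : ∃ k : ℕ, k = ⌈20 * L⌉₊ := ⟨_, rfl⟩
  have hklow : 20 * L ≤ k := hk ▸ Nat.le_ceil _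
  have hkup : (k : ℝ) < 20 * L + 1 := hk ▸ Nat.ceil_lt_add_one (by linarith)
  have hkpos : (0 : ℝ) < k := by linarith
  have hα : 1 / 200 / L ≤ 1 / (8 * k) := by
    rw [div_div]
    exact one_div_le_one_div_of_le (by positivity) (by linarith)
  have hα0 : 0 ≤ 1 / 200 / L := by positivity
  have hlevel : ∀ i : ℕ, ∃ f : V → V, (∀ u, d u (f u) ≤ 2 ^ i / 2) ∧
      k * ∑ v, p v * (if ∀ u, d v u ≤ 1 / 200 / L * 2 ^ i → f u = f v then 0 else 1) ≤
        ∑ v, p v * (Real.log (finBall d v (2 ^ (i + 1) / 4)).card -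
          Real.log (finBall d v (2 ^ i / 4)).card) := by
    intro i
    obtain ⟨f, hf, hcut⟩ := exists_assignment_weight_cut_le symm tri self hp
      (k := k) (r := 2 ^ i / 4) (t := 1 / (8 * k) * 2 ^ i) (by exact_mod_cast hkpos)
      (by positivity) (by positivity)
    have hrad : (2 : ℝ) ^ i / 4 + 2 * k * (1 / (8 * k) * 2 ^ i) = 2 ^ (i + 1) / 4 := by
      field_simp
      ring
    rw [hrad] at hf hcut
    refine ⟨f, fun u => (hf u).trans (le_of_eq (by ring)), le_trans ?_ hcut⟩
    refine mul_le_mul_of_nonneg_left (Finset.sum_le_sum fun v _ => ?_) hkpos.le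
    refine mul_le_mul_of_nonneg_left ?_ (hp v)
    by_cases hgood : ∀ u, d v u ≤ 1 / (8 * k) * 2 ^ i → f u = f v
    · rw [if_pos hgood, if_pos]
      exact fun u hu => hgood u (hu.trans (by gcongr))
    · rw [if_neg hgood]
      split_ifs <;> norm_num
  choose f hf hcut using hlevel
  refine ⟨HierDecomp.ofAssignments symm tri h hdiam f hf, ?_⟩
  set H := HierDecomp.ofAssignments symm tri h hdiam f hf with hH
  let bad : ℕ → V → ℝ := fun i v =>
    if ∀ u, d v u ≤ 1 / 200 / L * 2 ^ i → f i u = f i v then 0 else 1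
  have hbad0 : ∀ i v, 0 ≤ bad i v := fun i v => by
    simp only [bad]
    split_ifs <;> norm_num
  have hpad : ∀ v, p v - ∑ i ∈ Finset.range h, p v * bad i v ≤
      Set.indicator {u : V | H.Padded (1 / 200 / L) u} p v := by
    intro v
    have hnonneg : ∀ i ∈ Finset.range h, 0 ≤ p v * bad i v := fun i _ =>
      mul_nonneg (hp v) (hbad0 i v)
    by_cases hv : ∀ i < h, ∀ u, d v u ≤ 1 / 200 / L * 2 ^ i → f i u = f i v
    · rw [Set.indicator_of_mem]
      · linarith [Finset.sum_nonneg hnonneg]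
      · exact HierDecomp.padded_ofAssignments symm tri h hdiam f hf hα0 hv
    · rw [not_forall] at hv
      obtain ⟨i, hi⟩ := hv
      rw [Classical.not_imp] at hi
      have hone : bad i v = 1 := if_neg hi.2
      have hle := Finset.single_le_sum hnonneg (Finset.mem_range.2 hi.1)
      rw [hone, mul_one] at hle
      have := Set.indicator_nonneg (s := {u : V | H.Padded (1 / 200 / L) u})
        (fun x _ => hp x) v
      linarith
  have hgrow : ∀ v, ∑ i ∈ Finset.range h,
      (Real.log (finBall d v (2 ^ (i + 1) / 4)).card -
        Real.log (finBall d v (2 ^ i / 4)).card) ≤ L := by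
    intro v
    rw [Finset.sum_range_sub fun i => Real.log (finBall d v (2 ^ i / 4)).card]
    have hpos : ∀ i : ℕ, (1 : ℝ) ≤ (finBall d v (2 ^ i / 4)).card := by
      intro i
      exact_mod_cast Finset.card_pos.2 ⟨v, mem_finBall.2 (by rw [self]; positivity)⟩
    have h1 := Real.log_nonneg (hpos 0)
    have h2 : Real.log (finBall d v (2 ^ h / 4)).card ≤ L :=
      Real.log_le_log (by linarith [hpos h]) (by exact_mod_cast Finset.card_le_univ _)
    linarith
  have htotal : k * ∑ v, ∑ i ∈ Finset.range h, p v * bad i v ≤ L := by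
    rw [Finset.sum_comm, Finset.mul_sum]
    refine (Finset.sum_le_sum fun i _ => hcut i).trans ?_
    rw [Finset.sum_comm]
    calc _ ≤ ∑ v, p v * L := by
          refine Finset.sum_le_sum fun v _ => ?_
          rw [← Finset.mul_sum]
          exact mul_le_mul_of_nonneg_left (hgrow v) (hp v)
      _ = L := by rw [← Finset.sum_mul, hsum, one_mul]
  have hfinal := Finset.sum_le_sum fun v (_ : v ∈ Finset.univ) => hpad v
  rw [Finset.sum_sub_distrib, hsum] at hfinal
  have hsmall : ∑ v, ∑ i ∈ Finset.range h, p v * bad i v ≤ 0.05 := by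
    refine le_of_mul_le_mul_left (htotal.trans ?_) hkpos
    linarith
  refine le_trans ?_ hfinal
  linarith
end

section
/- There are universal constants c > 0 and C such that for every finite metric (V,d) on n ≥ 2 points with all distances at least 1, there exist hierarchical decompositions H_1,…,H_τ of (V,d) with τ ≤ C·log n such that every vertex v ∈ V is (c/log n)-padded in at least 0.9τ of the decompositions. -/
open Classical in
/-- The number of points at distance at most `r` from `v`. -/
noncomputable def ballCard {V : Type*} [Fintype V] (d : V → V → ℝ) (v : V) (r : ℝ) : ℕ :=
  (Finset.univ.filter fun u => d v u ≤ r).card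

section ballCard

variable {V : Type*} [Fintype V] {d : V → V → ℝ}

theorem ballCard_mono (v : V) {r s : ℝ} (h : r ≤ s) : ballCard d v r ≤ ballCard d v s := by
  classical
  unfold ballCard
  exact Finset.card_le_card (Finset.monotone_filter_right _ fun _ _ hu => hu.trans h)

theorem ballCard_pos (hself : ∀ v, d v v = 0) (v : V) {r : ℝ} (hr : 0 ≤ r) :
    0 < ballCard d v r := by
  classical
  unfold ballCard
  exact Finset.card_pos.2 ⟨v, by simp [hself, hr]⟩

theorem ballCard_le_card (v : V) (r : ℝ) : ballCard d v r ≤ Fintype.card V := by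
  classical
  unfold ballCard
  exact Finset.card_le_univ _

end ballCard

open Classical in
/-- Given a radius `β`, there is a clustering into clusters of radius at most `β` such that the
weight of the points whose `a`-ball is cut is controlled by the relative growth of balls between
the radii `β - a` and `β + a`. -/
theorem exists_clustering {V : Type*} [Fintype V] {d : V → V → ℝ}
    (hself : ∀ v, d v v = 0) (hsymm : ∀ u v, d u v = d v u)
    (htri : ∀ u v x, d u x ≤ d u v + d v x) {a β : ℝ} (ha : 0 ≤ a) (hβ : 0 ≤ β)
    {w : V → ℝ} (hw : ∀ v, 0 ≤ w v) (Z : Finset V) :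
    ∃ l : V → V, (∀ v, d (l v) v ≤ β) ∧
      ∑ v ∈ Z.filter (fun v => ∃ x, d v x ≤ a ∧ l x ≠ l v), w v ≤
        ∑ v ∈ Z, w v * (((ballCard d v (β + a) : ℝ) - ballCard d v (β - a)) /
          ballCard d v (β + a)) := by
  induction Z using Finset.strongInduction with
  | H Z ih =>
    rcases Z.eq_empty_or_nonempty with rfl | ⟨z, hz⟩
    · exact ⟨id, fun v => by simpa [hself] using hβ, by simp⟩
    set p : V → ℝ := fun v => ((ballCard d v (β + a) : ℝ) - ballCard d v (β - a)) /
          ballCard d v (β + a) with hp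
    have hpos : ∀ v, (0 : ℝ) < ballCard d v (β + a) := fun v => by
      exact_mod_cast ballCard_pos hself v (by positivity)
    have hcenter : ∃ u, (∃ v ∈ Z, d u v ≤ β + a) ∧
        ∑ v ∈ Z.filter (fun v => β - a < d u v ∧ d u v ≤ β + a), w v ≤
          ∑ v ∈ Z.filter (fun v => d u v ≤ β + a), w v * p v := by
      by_contra! hcon
      have hlt : ∑ u, ∑ v ∈ Z.filter (fun v => d u v ≤ β + a), w v * p v <
          ∑ u, ∑ v ∈ Z.filter (fun v => β - a < d u v ∧ d u v ≤ β + a), w v := by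
        refine Finset.sum_lt_sum (fun u _ => ?_)
          ⟨z, Finset.mem_univ _, hcon z ⟨z, hz, by rw [hself]; positivity⟩⟩
        by_cases hu : ∃ v ∈ Z, d u v ≤ β + a
        · exact (hcon u hu).le
        · push Not at hu
          rw [Finset.filter_false_of_mem fun v hv => not_le.2 (hu v hv)]
          simpa using Finset.sum_nonneg fun v _ => hw v
      refine hlt.ne ?_
      simp_rw [Finset.sum_filter]
      rw [Finset.sum_comm, Finset.sum_comm (s := Finset.univ)]
      refine Finset.sum_congr rfl fun v _ => ?_
      simp_rw [← Finset.sum_filter, Finset.sum_const, nsmul_eq_mul]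
      have h1 : ((Finset.univ.filter fun u => d u v ≤ β + a).card : ℝ) =
          ballCard d v (β + a) := by
        unfold ballCard; simp_rw [hsymm v]
      have h2 : ((Finset.univ.filter fun u => β - a < d u v ∧ d u v ≤ β + a).card : ℝ) =
          (ballCard d v (β + a) : ℝ) - ballCard d v (β - a) := by
        unfold ballCard
        simp_rw [hsymm v]
        rw [eq_sub_iff_add_eq, ← Nat.cast_add, ← Finset.card_union_of_disjoint]
        · congr 2
          ext u
          simp only [Finset.mem_union, Finset.mem_filter, Finset.mem_univ, true_and]
          grind
        · rw [Finset.disjoint_filter]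
          intro u _ hu
          exact not_le.2 hu.1
      rw [h1, h2]
      have := (hpos v).ne'
      simp only [hp]
      field_simp
    obtain ⟨u, ⟨y, hyZ, hy⟩, hu⟩ := hcenter
    obtain ⟨l, hl, hsum⟩ := ih (Z.filter fun v => ¬ d u v ≤ β + a)
      (Finset.filter_ssubset.2 ⟨y, hyZ, by simpa using hy⟩)
    refine ⟨fun v => if d u v ≤ β then u else l v, fun v => ?_, ?_⟩
    · dsimp only
      split_ifs with h
      exacts [h, hl v]
    · rw [← Finset.sum_filter_add_sum_filter_not Z (fun v => d u v ≤ β + a)]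
      refine le_trans ?_ (add_le_add hu hsum)
      have hnn : ∀ s : Finset V, 0 ≤ ∑ v ∈ s, w v := fun s => Finset.sum_nonneg fun v _ => hw v
      refine (Finset.sum_le_sum_of_subset_of_nonneg ?_ fun v _ _ => hw v).trans
        ((le_add_of_nonneg_right (hnn _)).trans_eq (Finset.sum_union_inter
          (s₁ := Z.filter fun v => β - a < d u v ∧ d u v ≤ β + a)
          (s₂ := (Z.filter fun v => ¬ d u v ≤ β + a).filter
            fun v => ∃ x, d v x ≤ a ∧ l x ≠ l v)))
      intro v hv
      simp only [Finset.mem_union, Finset.mem_filter] at hv ⊢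
      obtain ⟨hvZ, x, hx, hne⟩ := hv
      have h1 := htri u v x
      have h2 := htri u x v
      rw [hsymm x v] at h2
      by_cases hva : d u v ≤ β + a
      · refine Or.inl ⟨hvZ, ?_, hva⟩
        by_contra! hle
        rw [if_pos (by linarith), if_pos (by linarith)] at hne
        exact hne rfl
      · refine Or.inr ⟨⟨hvZ, hva⟩, x, hx, ?_⟩
        rwa [if_neg (by linarith), if_neg (by linarith)] at hne

/-- Multiplicative weights: if for all weights some `ω` is good for all but a `ε`-fraction of the
weight, then some sequence has small exponential moment of the number of failures. -/
theorem exists_sequence_prod_le {Ω V : Type*} [Fintype V] (G : Ω → V → Prop)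
    [∀ ω, DecidablePred (G ω)] {ε : ℝ} (hε : 0 ≤ ε)
    (hG : ∀ w : V → ℝ, (∀ v, 0 ≤ w v) →
      ∃ ω, ∑ v ∈ Finset.univ.filter (fun v => ¬ G ω v), w v ≤ ε * ∑ v, w v) (τ : ℕ) :
    ∃ H : Fin τ → Ω, ∑ v, ∏ i, (if G (H i) v then (1 : ℝ) else 2) ≤
      Fintype.card V * (1 + ε) ^ τ := by
  induction τ with
  | zero => exact ⟨Fin.elim0, by simp⟩
  | succ τ ih =>
    obtain ⟨H, hH⟩ := ih
    obtain ⟨ω, hω⟩ := hG (fun v => ∏ i, (if G (H i) v then (1 : ℝ) else 2))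
      fun v => Finset.prod_nonneg fun i _ => by split_ifs <;> norm_num
    refine ⟨Fin.cons ω H, ?_⟩
    simp only [Fin.prod_univ_succ, Fin.cons_zero, Fin.cons_succ]
    calc _ = ∑ v, (∏ i, (if G (H i) v then (1 : ℝ) else 2)) +
          ∑ v ∈ Finset.univ.filter (fun v => ¬ G ω v),
            ∏ i, (if G (H i) v then (1 : ℝ) else 2) := by
          rw [Finset.sum_filter, ← Finset.sum_add_distrib]
          refine Finset.sum_congr rfl fun v _ => ?_
          by_cases h : G ω v <;> simp [h]; ring
      _ ≤ (1 + ε) * ∑ v, (∏ i, (if G (H i) v then (1 : ℝ) else 2)) := by linarith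
      _ ≤ (1 + ε) * (Fintype.card V * (1 + ε) ^ τ) := by gcongr
      _ = _ := by ring

/-- The setoid identifying points which have equal labels at all levels in `[i, h)`. -/
def labelSetoid {V : Type*} (l : ℕ → V → V) (h i : ℕ) : Setoid V where
  r u v := ∀ j, i ≤ j → j < h → l j u = l j v
  iseqv := ⟨fun _ _ _ _ => rfl, fun H j hj hj' => (H j hj hj').symm,
    fun H H' j hj hj' => (H j hj hj').trans (H' j hj hj')⟩

/-- The hierarchical decomposition obtained from a clustering at every level by common
refinement. -/
def HierDecomp.ofLabels {V : Type*} [Nonempty V] {d : V → V → ℝ} (h : ℕ)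
    (hd : ∀ u v, d u v ≤ 2 ^ h) (l : ℕ → V → V)
    (hl : ∀ j u v, l j u = l j v → d u v ≤ 2 ^ j) : HierDecomp V d where
  h := h
  P i := (labelSetoid l h i).classes
  partition i _ := Setoid.isPartition_classes _
  top := by
    have huniv : ∀ y, {x | (labelSetoid l h h) x y} = Set.univ := fun y =>
      Set.eq_univ_of_forall fun x j hj hj' => absurd hj' (not_lt.2 hj)
    ext s
    simp only [Setoid.classes, Set.mem_ofPred_eq, huniv, exists_const, Set.mem_singleton_iff]
  part_diam := by
    rintro i hi _ ⟨y, rfl⟩ u hu v hv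
    rcases hi.eq_or_lt with rfl | hi
    · exact hd u v
    · exact hl i u v ((hu i le_rfl hi).trans (hv i le_rfl hi).symm)
  refines := by
    rintro i - _ ⟨y, rfl⟩
    exact ⟨_, ⟨y, rfl⟩, fun x hx j hj hj' => hx j (by omega) hj'⟩
  metric_diam := hd

theorem HierDecomp.padded_ofLabels {V : Type*} [Nonempty V] {d : V → V → ℝ} (h : ℕ)
    (hd : ∀ u v, d u v ≤ 2 ^ h) (l : ℕ → V → V)
    (hl : ∀ j u v, l j u = l j v → d u v ≤ 2 ^ j) {α : ℝ} (hα : 0 ≤ α) {v : V}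
    (hv : ∀ j < h, ∀ x, d v x ≤ α * 2 ^ j → l j x = l j v) :
    (HierDecomp.ofLabels h hd l hl).Padded α v := by
  intro i _
  refine ⟨_, ⟨v, rfl⟩, fun x hx j hj hj' => hv j hj' x ?_⟩
  refine le_trans hx ?_
  gcongr
  norm_num

theorem sum_growth_le_log_card {V : Type*} [Fintype V] {d : V → V → ℝ}
    (hself : ∀ v, d v v = 0) {α : ℝ} (hα : 0 ≤ α) {K : ℕ} (hK : 8 * K * α ≤ 1) (h : ℕ) (v : V) :
    ∑ j ∈ Finset.range h, ∑ k ∈ Finset.range K,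
      ((ballCard d v (2 ^ j / 4 + 2 * (k + 1 : ℕ) * (α * 2 ^ j)) : ℝ) -
        ballCard d v (2 ^ j / 4 + 2 * k * (α * 2 ^ j))) /
        ballCard d v (2 ^ j / 4 + 2 * (k + 1 : ℕ) * (α * 2 ^ j)) ≤
      Real.log (Fintype.card V) := by
  have hpos : ∀ r : ℝ, 0 ≤ r → (0 : ℝ) < ballCard d v r := fun r hr => by
    exact_mod_cast ballCard_pos hself v hr
  have hlevel : ∀ j ∈ Finset.range h, ∑ k ∈ Finset.range K,
      ((ballCard d v (2 ^ j / 4 + 2 * (k + 1 : ℕ) * (α * 2 ^ j)) : ℝ) -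
        ballCard d v (2 ^ j / 4 + 2 * k * (α * 2 ^ j))) /
        ballCard d v (2 ^ j / 4 + 2 * (k + 1 : ℕ) * (α * 2 ^ j)) ≤
      Real.log (ballCard d v (2 ^ (j + 1) / 4)) - Real.log (ballCard d v (2 ^ j / 4)) := by
    intro j _
    calc _ ≤ ∑ k ∈ Finset.range K,
          (Real.log (ballCard d v (2 ^ j / 4 + 2 * (k + 1 : ℕ) * (α * 2 ^ j))) -
            Real.log (ballCard d v (2 ^ j / 4 + 2 * k * (α * 2 ^ j)))) := by
          refine Finset.sum_le_sum fun k _ => ?_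
          have h1 := hpos (2 ^ j / 4 + 2 * (k + 1 : ℕ) * (α * 2 ^ j)) (by positivity)
          have h0 := hpos (2 ^ j / 4 + 2 * k * (α * 2 ^ j)) (by positivity)
          have := Real.one_sub_inv_le_log_of_pos (div_pos h1 h0)
          rw [Real.log_div h1.ne' h0.ne', inv_div] at this
          rwa [sub_div, div_self h1.ne']
      _ = Real.log (ballCard d v (2 ^ j / 4 + 2 * K * (α * 2 ^ j))) -
            Real.log (ballCard d v (2 ^ j / 4)) := by
          rw [Finset.sum_range_sub
            (fun k : ℕ => Real.log (ballCard d v (2 ^ j / 4 + 2 * k * (α * 2 ^ j))))]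
          simp
      _ ≤ _ := by
          refine sub_le_sub_right (Real.log_le_log (hpos _ (by positivity)) ?_) _
          refine Nat.cast_le.2 (ballCard_mono v ?_)
          have h2 : (0 : ℝ) < 2 ^ j := by positivity
          rw [pow_succ]
          nlinarith
  refine (Finset.sum_le_sum hlevel).trans ?_
  rw [Finset.sum_range_sub (fun j : ℕ => Real.log (ballCard d v (2 ^ j / 4)))]
  have h1 : Real.log (ballCard d v (2 ^ h / 4)) ≤ Real.log (Fintype.card V) :=
    Real.log_le_log (hpos _ (by positivity)) (Nat.cast_le.2 (ballCard_le_card v _))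
  have h0 : 0 ≤ Real.log (ballCard d v (2 ^ 0 / 4)) := Real.log_natCast_nonneg _
  linarith

open Classical in
/-- For all weights there is a hierarchical decomposition in which all but a small fraction of the
weight is padded. -/
theorem exists_hierDecomp_weight_le {V : Type*} [Fintype V] [Nonempty V] {d : V → V → ℝ}
    (hself : ∀ v, d v v = 0) (hsymm : ∀ u v, d u v = d v u)
    (htri : ∀ u v x, d u x ≤ d u v + d v x) {α : ℝ} (hα : 0 ≤ α) {K : ℕ} (hK0 : 0 < K)
    (hK : 8 * K * α ≤ 1) {w : V → ℝ} (hw : ∀ v, 0 ≤ w v) :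
    ∃ H : HierDecomp V d, ∑ v ∈ Finset.univ.filter (fun v => ¬ H.Padded α v), w v ≤
      Real.log (Fintype.card V) / K * ∑ v, w v := by
  obtain ⟨h, hh⟩ : ∃ h : ℕ, ∀ u v, d u v ≤ 2 ^ h := by
    obtain ⟨M, hM⟩ := Finite.bddAbove_range (fun q : V × V => d q.1 q.2)
    obtain ⟨h, hh⟩ := pow_unbounded_of_one_lt M (one_lt_two : (1 : ℝ) < 2)
    exact ⟨h, fun u v => (hM ⟨(u, v), rfl⟩).trans hh.le⟩
  set g : ℕ → ℕ → V → ℝ := fun j k v =>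
    ((ballCard d v (2 ^ j / 4 + 2 * (k + 1 : ℕ) * (α * 2 ^ j)) : ℝ) -
        ballCard d v (2 ^ j / 4 + 2 * k * (α * 2 ^ j))) /
        ballCard d v (2 ^ j / 4 + 2 * (k + 1 : ℕ) * (α * 2 ^ j)) with hg
  obtain ⟨k, hkK, hk⟩ : ∃ k ∈ Finset.range K, ∑ j ∈ Finset.range h, ∑ v, w v * g j k v ≤
      Real.log (Fintype.card V) / K * ∑ v, w v := by
    refine Finset.exists_le_of_sum_le (Finset.nonempty_range_iff.2 hK0.ne') ?_
    have hK' : (K : ℝ) ≠ 0 := by positivity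
    calc _ = ∑ v, w v * ∑ j ∈ Finset.range h, ∑ k ∈ Finset.range K, g j k v := by
          simp_rw [Finset.mul_sum]
          rw [Finset.sum_comm]
          simp_rw [Finset.sum_comm (s := Finset.range K)]
          rw [Finset.sum_comm]
      _ ≤ ∑ v, w v * Real.log (Fintype.card V) :=
          Finset.sum_le_sum fun v _ =>
            mul_le_mul_of_nonneg_left (sum_growth_le_log_card hself hα hK h v) (hw v)
      _ = _ := by
          rw [← Finset.sum_mul, Finset.sum_const, Finset.card_range, nsmul_eq_mul]
          field_simp
  have hcluster : ∀ j : ℕ, ∃ l : V → V, (∀ v, d (l v) v ≤ 2 ^ j / 2) ∧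
      ∑ v ∈ Finset.univ.filter (fun v => ∃ x, d v x ≤ α * 2 ^ j ∧ l x ≠ l v), w v ≤
        ∑ v, w v * g j k v := by
    intro j
    obtain ⟨l, hl, hs⟩ := exists_clustering hself hsymm htri (a := α * 2 ^ j)
      (β := 2 ^ j / 4 + (2 * k + 1) * (α * 2 ^ j)) (by positivity) (by positivity) hw Finset.univ
    refine ⟨l, fun v => (hl v).trans ?_, hs.trans_eq ?_⟩
    · have hkK' : (k : ℝ) + 1 ≤ K := by exact_mod_cast Finset.mem_range.1 hkK
      have h2 : (0 : ℝ) < 2 ^ j := by positivity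
      have h3 : (2 * k + 1) * α ≤ 1 / 4 := by nlinarith
      nlinarith
    · refine Finset.sum_congr rfl fun v _ => ?_
      have e1 : (2 : ℝ) ^ j / 4 + (2 * k + 1) * (α * 2 ^ j) + α * 2 ^ j =
        2 ^ j / 4 + 2 * (k + 1 : ℕ) * (α * 2 ^ j) := by push_cast; ring
      have e2 : (2 : ℝ) ^ j / 4 + (2 * k + 1) * (α * 2 ^ j) - α * 2 ^ j =
        2 ^ j / 4 + 2 * k * (α * 2 ^ j) := by ring
      rw [e1, e2]
  choose l hl hs using hcluster
  have hdiam : ∀ j u v, l j u = l j v → d u v ≤ 2 ^ j := fun j u v huv => by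
    have h1 := hl j u
    have h2 := hl j v
    have h3 := htri u (l j u) v
    rw [hsymm u (l j u)] at h3
    rw [← huv] at h2
    linarith
  refine ⟨HierDecomp.ofLabels h hh l hdiam, le_trans ?_ hk⟩
  refine le_trans ?_ (Finset.sum_le_sum fun j _ => hs j)
  simp_rw [Finset.sum_filter]
  rw [Finset.sum_comm]
  refine Finset.sum_le_sum fun v _ => ?_
  have hnn : ∀ j ∈ Finset.range h,
      0 ≤ if ∃ x, d v x ≤ α * 2 ^ j ∧ l j x ≠ l j v then w v else 0 := fun j _ => by
    split_ifs
    exacts [hw v, le_rfl]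
  split_ifs with hv
  · exact Finset.sum_nonneg hnn
  · by_contra! hlt
    refine hv (HierDecomp.padded_ofLabels h hh l hdiam hα fun j hj x hx => ?_)
    by_contra hne
    have := Finset.single_le_sum hnn (Finset.mem_range.2 hj)
    rw [if_pos ⟨x, hx, hne⟩] at this
    linarith

/-- There are universal constants `c > 0` and `C` such that every
finite metric on `n ≥ 2` points with all distances at least `1` admits hierarchical
decompositions `H₁,…,H_τ` with `τ ≤ C·log n` such that every vertex is `(c/log n)`-padded
in at least `0.9τ` of them. -/
theorem exists_hierDecomp_family_padded :
    ∃ c C : ℝ, 0 < c ∧ 0 < C ∧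
      ∀ (V : Type) [Fintype V], ∀ d : V → V → ℝ,
        2 ≤ Fintype.card V →
        (∀ u v : V, d u v = d v u) →
        (∀ u v x : V, d u x ≤ d u v + d v x) →
        (∀ u v : V, d u v = 0 ↔ u = v) →
        (∀ u v : V, u ≠ v → 1 ≤ d u v) →
        ∃ (τ : ℕ) (H : Fin τ → HierDecomp V d),
          1 ≤ τ ∧ (τ : ℝ) ≤ C * Real.log (Fintype.card V : ℝ) ∧
          ∀ v : V, (0.9 : ℝ) * (τ : ℝ) ≤
            ({i : Fin τ | (H i).Padded (c / Real.log (Fintype.card V : ℝ)) v}.ncard : ℝ) := by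
  classical
  refine ⟨1 / 1000, 22, by norm_num, by norm_num, ?_⟩
  intro V _ d hn hsymm htri hzero _
  have hself : ∀ v, d v v = 0 := fun v => (hzero v v).2 rfl
  have : Nonempty V := Fintype.card_pos_iff.1 (by omega)
  have hn' : (2 : ℝ) ≤ Fintype.card V := by exact_mod_cast hn
  have hlog2 := Real.log_two_gt_d9
  set L : ℝ := Real.log (Fintype.card V) with hL
  have hL2 : Real.log 2 ≤ L := Real.log_le_log (by norm_num) hn'
  have hLpos : 0 < L := by linarith
  have hKpos : 0 < ⌈100 * L⌉₊ := Nat.ceil_pos.2 (by positivity)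
  have hK1 : 100 * L ≤ ⌈100 * L⌉₊ := Nat.le_ceil _
  have hK2 : (⌈100 * L⌉₊ : ℝ) < 100 * L + 1 := Nat.ceil_lt_add_one (by positivity)
  have hKα : 8 * (⌈100 * L⌉₊ : ℝ) * (1 / 1000 / L) ≤ 1 := by
    rw [← mul_div_assoc, div_le_one hLpos]
    linarith
  have hG : ∀ w : V → ℝ, (∀ v, 0 ≤ w v) → ∃ H : HierDecomp V d,
      ∑ v ∈ Finset.univ.filter (fun v => ¬ H.Padded (1 / 1000 / L) v), w v ≤
        1 / 100 * ∑ v, w v := fun w hw => by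
    obtain ⟨H, hH⟩ := exists_hierDecomp_weight_le hself hsymm htri
      (by positivity : 0 ≤ 1 / 1000 / L) hKpos hKα hw
    refine ⟨H, hH.trans (mul_le_mul_of_nonneg_right ?_ (Finset.sum_nonneg fun v _ => hw v))⟩
    rw [div_le_iff₀ (by exact_mod_cast hKpos)]
    linarith
  set τ : ℕ := ⌈20 * L⌉₊ with hτ
  have hτ1 : 20 * L ≤ τ := Nat.le_ceil _
  have hτ2 : (τ : ℝ) < 20 * L + 1 := Nat.ceil_lt_add_one (by positivity)
  obtain ⟨H, hH⟩ := exists_sequence_prod_le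
    (fun (H : HierDecomp V d) v => H.Padded (1 / 1000 / L) v) (by norm_num) hG τ
  refine ⟨τ, H, Nat.ceil_pos.2 (by positivity), by linarith, fun v => ?_⟩
  set b : ℕ := (Finset.univ.filter fun i => ¬ (H i).Padded (1 / 1000 / L) v).card with hb
  have hcount : ({i : Fin τ | (H i).Padded (1 / 1000 / L) v}.ncard : ℝ) + b = τ := by
    have := Finset.card_filter_add_card_filter_not (s := (Finset.univ : Finset (Fin τ)))
      (fun i => (H i).Padded (1 / 1000 / L) v)
    rw [Finset.card_univ, Fintype.card_fin] at this
    rw [Set.ncard_eq_toFinset_card', Set.toFinset_ofPred]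
    exact_mod_cast this
  have hpow : (2 : ℝ) ^ b ≤ Fintype.card V * (1 + 1 / 100) ^ τ := by
    refine le_trans ?_ hH
    refine le_trans (le_of_eq ?_) (Finset.single_le_sum (fun v _ => Finset.prod_nonneg fun i _ => ?_)
      (Finset.mem_univ v))
    · rw [Finset.prod_ite, Finset.prod_const_one, one_mul, Finset.prod_const]
    · split_ifs <;> norm_num
  have hlog : b * Real.log 2 ≤ L + τ * (1 / 100) := by
    have h1 := Real.log_le_log (by positivity) hpow
    rw [Real.log_mul (by positivity) (by positivity), Real.log_pow, Real.log_pow] at h1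
    have h2 : Real.log (1 + 1 / 100) ≤ 1 / 100 := by
      have := Real.log_le_sub_one_of_pos (by norm_num : (0 : ℝ) < 1 + 1 / 100)
      linarith
    have h3 := mul_le_mul_of_nonneg_left h2 (Nat.cast_nonneg (α := ℝ) τ)
    linarith
  have hb0 : (0 : ℝ) ≤ b := Nat.cast_nonneg _
  have hbτ : (b : ℝ) ≤ τ / 10 := by nlinarith
  linarith
end

section
/- For every constant c > 0 there is a constant C such that for every weighted graph G=(V,E,w) on n ≥ 2 vertices with all edge weights at least 1, every root r ∈ V, and every m ≤ n^c, there exists a well-separated (C·log²n)-approximate demand-robust copy tree embedding of (G,r) for tuples of length m+1. -/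
/-- An edge set `F` connects vertices `u` and `v` if they lie in the same connected
component of the graph with edge set `F`. -/
def EdgeConn {V : Type*} (F : Set (Sym2 V)) (u v : V) : Prop :=
  (SimpleGraph.fromEdgeSet F).Reachable u v

/-- Vertex sets `U` and `W` are connected by the edge set `F`. -/
def SetConn {V : Type*} (F : Set (Sym2 V)) (U W : Set V) : Prop :=
  ∃ u ∈ U, ∃ w ∈ W, EdgeConn F u w

/-- A rooted weighted tree is well-separated if every child edge has weight at most half
the weight of its parent edge. -/
def WellSeparated {V : Type*} (T : SimpleGraph V) (root : V) (w : Sym2 V → ℝ) : Prop :=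
  ∀ a b c : V, T.Adj a b → T.Adj b c →
    T.dist root b = T.dist root a + 1 → T.dist root c = T.dist root b + 1 →
    w s(b, c) ≤ w s(a, b) / 2

/-- An `α`-approximate demand-robust copy tree embedding of the weighted graph `(G, w)`
with root `r` for tuples of length `m+1`: a weighted rooted tree together with a copy
mapping and forward/backward mappings of `(m+1)`-tuples of edge sets which preserve the
connectivity of `X₀ ∪ Xᵢ` for each scenario `i ≥ 1` and (`α`-approximately) preserve the
cost of each coordinate. -/
structure DRCopyTreeEmbedding (V V' : Type*) (G : SimpleGraph V) (w : Sym2 V → ℝ)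
    (r : V) (α : ℝ) (m : ℕ) where
  tree : SimpleGraph V'
  isTree : tree.IsTree
  w' : Sym2 V' → ℝ
  root : V'
  copies : V → Set V'
  copies_nonempty : ∀ v : V, (copies v).Nonempty
  copies_disjoint : ∀ u v : V, u ≠ v → Disjoint (copies u) (copies v)
  copies_cover : ∀ v' : V', ∃ v : V, v' ∈ copies v
  copies_root : copies r = {root}
  mapGT : (Fin (m + 1) → Finset (Sym2 V)) → Fin (m + 1) → Finset (Sym2 V')
  mapTG : (Fin (m + 1) → Finset (Sym2 V')) → Fin (m + 1) → Finset (Sym2 V)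
  mapGT_sub : ∀ X : Fin (m + 1) → Finset (Sym2 V), (∀ i, ↑(X i) ⊆ G.edgeSet) →
      ∀ i, ↑(mapGT X i) ⊆ tree.edgeSet
  mapTG_sub : ∀ X' : Fin (m + 1) → Finset (Sym2 V'), (∀ i, ↑(X' i) ⊆ tree.edgeSet) →
      ∀ i, ↑(mapTG X' i) ⊆ G.edgeSet
  conn_GT : ∀ X : Fin (m + 1) → Finset (Sym2 V), (∀ i, ↑(X i) ⊆ G.edgeSet) →
      ∀ i : Fin (m + 1), i ≠ 0 → ∀ u v : V,
      EdgeConn ((↑(X 0) : Set (Sym2 V)) ∪ ↑(X i)) u v →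
      SetConn ((↑(mapGT X 0) : Set (Sym2 V')) ∪ ↑(mapGT X i)) (copies u) (copies v)
  cost_GT : ∀ X : Fin (m + 1) → Finset (Sym2 V), (∀ i, ↑(X i) ⊆ G.edgeSet) →
      ∀ i, ∑ e ∈ mapGT X i, w' e ≤ α * ∑ e ∈ X i, w e
  conn_TG : ∀ X' : Fin (m + 1) → Finset (Sym2 V'), (∀ i, ↑(X' i) ⊆ tree.edgeSet) →
      ∀ i : Fin (m + 1), i ≠ 0 → ∀ (u v : V) (u' v' : V'),
      u' ∈ copies u → v' ∈ copies v →
      EdgeConn ((↑(X' 0) : Set (Sym2 V')) ∪ ↑(X' i)) u' v' →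
      EdgeConn ((↑(mapTG X' 0) : Set (Sym2 V)) ∪ ↑(mapTG X' i)) u v
  cost_TG : ∀ X' : Fin (m + 1) → Finset (Sym2 V'), (∀ i, ↑(X' i) ⊆ tree.edgeSet) →
      ∀ i, ∑ e ∈ mapTG X' i, w e ≤ ∑ e ∈ X' i, w' e

/-- A pseudometric whose distinct points are at distance at least one. -/
structure IsUnitSeparatedMetric {V : Type*} (d : V → V → ℝ) : Prop where
  self : ∀ u, d u u = 0
  symm : ∀ u v, d u v = d v u
  triangle : ∀ u v x, d u x ≤ d u v + d v x
  one_le : ∀ u v, u ≠ v → 1 ≤ d u v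

lemma EdgeConn.mono {V : Type*} {F F' : Set (Sym2 V)} (h : F ⊆ F') {u v : V}
    (huv : EdgeConn F u v) : EdgeConn F' u v :=
  SimpleGraph.Reachable.mono (SimpleGraph.fromEdgeSet_mono h) huv

lemma EdgeConn.of_mem {V : Type*} {F : Set (Sym2 V)} {u v : V} (h : s(u, v) ∈ F) :
    EdgeConn F u v := by
  by_cases huv : u = v
  · subst huv; exact SimpleGraph.Reachable.refl _
  · exact SimpleGraph.Adj.reachable ((SimpleGraph.fromEdgeSet_adj F).2 ⟨h, huv⟩)

/-- Connectivity transfers along a map sending each edge of `F` to a connected pair. -/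
lemma EdgeConn.map {V W : Type*} {F : Set (Sym2 V)} {F' : Set (Sym2 W)} (f : V → W)
    (hf : ∀ u v, s(u, v) ∈ F → EdgeConn F' (f u) (f v)) {u v : V} (huv : EdgeConn F u v) :
    EdgeConn F' (f u) (f v) := by
  obtain ⟨p⟩ := huv
  induction p with
  | nil => exact SimpleGraph.Reachable.refl _
  | cons h _ ih => exact (hf _ _ ((SimpleGraph.fromEdgeSet_adj F).1 h).1).trans ih

lemma exists_minimal_connecting_edges {V : Type*} [Finite V] (G : SimpleGraph V)
    (hG : G.Connected) (w : Sym2 V → ℝ) (u v : V) :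
    ∃ F : Finset (Sym2 V), (F : Set (Sym2 V)) ⊆ G.edgeSet ∧ EdgeConn (F : Set (Sym2 V)) u v ∧
      ∀ F' : Finset (Sym2 V), (F' : Set (Sym2 V)) ⊆ G.edgeSet →
        EdgeConn (F' : Set (Sym2 V)) u v → ∑ e ∈ F, w e ≤ ∑ e ∈ F', w e := by
  classical
  have := Fintype.ofFinite V
  have hne : {F : Finset (Sym2 V) | (F : Set (Sym2 V)) ⊆ G.edgeSet ∧
      EdgeConn (F : Set (Sym2 V)) u v}.Nonempty := by
    refine ⟨G.edgeFinset, by simp, ?_⟩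
    simpa [EdgeConn] using hG u v
  obtain ⟨F, hF, hmin⟩ := Set.exists_min_image _ (fun F : Finset (Sym2 V) => ∑ e ∈ F, w e)
    (Set.toFinite _) hne
  exact ⟨F, hF.1, hF.2, fun F' h1 h2 => hmin F' ⟨h1, h2⟩⟩

/-- Cheapest connecting edge sets induce a metric bounded by the edge weights. -/
lemma exists_connecting_edges_metric {V : Type*} [Finite V] (G : SimpleGraph V)
    (hG : G.Connected) (w : Sym2 V → ℝ) (hw : ∀ e ∈ G.edgeSet, 1 ≤ w e) :
    ∃ P : V → V → Finset (Sym2 V), (∀ u v, (P u v : Set (Sym2 V)) ⊆ G.edgeSet) ∧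
      (∀ u v, EdgeConn (P u v : Set (Sym2 V)) u v) ∧
      IsUnitSeparatedMetric (fun u v => ∑ e ∈ P u v, w e) ∧
      ∀ u v, s(u, v) ∈ G.edgeSet → ∑ e ∈ P u v, w e ≤ w s(u, v) := by
  classical
  choose P hsub hconn hmin using exists_minimal_connecting_edges G hG w
  have hpos : ∀ F : Finset (Sym2 V), (F : Set (Sym2 V)) ⊆ G.edgeSet → ∀ e ∈ F, 0 ≤ w e :=
    fun F hF e he => zero_le_one.trans (hw e (hF he))
  refine ⟨P, hsub, hconn, ⟨fun u => ?_, fun u v => ?_, fun u v x => ?_, fun u v huv => ?_⟩,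
    fun u v huv => ?_⟩
  · refine le_antisymm ?_ (Finset.sum_nonneg (hpos _ (hsub u u)))
    simpa using hmin u u ∅ (by simp) (SimpleGraph.Reachable.refl _)
  · exact le_antisymm (hmin u v _ (hsub v u) (hconn v u).symm)
      (hmin v u _ (hsub u v) (hconn u v).symm)
  · refine (hmin u x (P u v ∪ P v x) ?_ ?_).trans ?_
    · rw [Finset.coe_union]; exact Set.union_subset (hsub _ _) (hsub _ _)
    · rw [Finset.coe_union]
      exact ((hconn u v).mono Set.subset_union_left).trans
        ((hconn v x).mono Set.subset_union_right)
    · rw [← Finset.sum_union_inter]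
      exact le_add_of_nonneg_right
        (Finset.sum_nonneg fun e he => hpos _ (hsub u v) e (Finset.mem_inter.1 he).1)
  · have hne : (P u v).Nonempty := by
      by_contra h
      have h2 := hconn u v
      rw [Finset.not_nonempty_iff_eq_empty.1 h] at h2
      simp [EdgeConn, huv] at h2
    obtain ⟨e, he⟩ := hne
    exact (hw e (hsub u v he)).trans (Finset.single_le_sum (hpos _ (hsub u v)) he)
  · simpa using hmin u v {s(u, v)} (by simpa using huv) (EdgeConn.of_mem (by simp))

/-- A greedy cover: if every index is good for at least half of the samples, then
logarithmically many samples cover all indices. -/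
lemma exists_small_hitting_set {Ω ι : Type*} [Fintype Ω] [Nonempty Ω] (good : ι → Finset Ω)
    (hgood : ∀ i, Fintype.card Ω ≤ 2 * (good i).card) (J : Finset ι) :
    ∃ S : Finset Ω, (S = ∅ ∨ 2 ^ S.card ≤ 2 * J.card) ∧ (∀ i ∈ J, ∃ ω ∈ S, ω ∈ good i) ∧
      ∀ ω ∈ S, ∃ i ∈ J, ω ∈ good i := by
  classical
  induction J using Finset.strongInduction with
  | H J ih =>
    rcases J.eq_empty_or_nonempty with rfl | hJ
    · exact ⟨∅, by simp⟩
    obtain ⟨ω, -, hω⟩ : ∃ ω ∈ (Finset.univ : Finset Ω),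
        J.card ≤ 2 * (J.filter (ω ∈ good ·)).card := by
      refine Finset.exists_le_of_sum_le Finset.univ_nonempty ?_
      have h1 : ∑ ω : Ω, (J.filter (ω ∈ good ·)).card = ∑ i ∈ J, (good i).card := by
        simp only [Finset.card_filter]
        rw [Finset.sum_comm]
        simp
      rw [← Finset.mul_sum, h1, Finset.mul_sum, Finset.sum_const, Finset.card_univ, smul_eq_mul,
        mul_comm, ← smul_eq_mul, ← Finset.sum_const]
      exact Finset.sum_le_sum fun i _ => hgood i
    have hadd := Finset.card_filter_add_card_filter_not (s := J) (ω ∈ good ·)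
    have hJ' := hJ.card_pos
    obtain ⟨S, hS1, hS2, hS3⟩ := ih (J.filter (ω ∉ good ·)) (by
      refine (Finset.filter_subset _ _).ssubset_of_ne fun h => ?_
      rw [h] at hadd; omega)
    refine ⟨insert ω S, Or.inr ?_, fun i hi => ?_, fun ω' hω' => ?_⟩
    · have hc := Finset.card_insert_le ω S
      rcases hS1 with rfl | hS1
      · simp; omega
      · calc 2 ^ (insert ω S).card ≤ 2 ^ (S.card + 1) := Nat.pow_le_pow_right two_pos hc
          _ ≤ 2 * J.card := by rw [pow_succ]; omega
    · by_cases h : ω ∈ good i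
      · exact ⟨ω, Finset.mem_insert_self _ _, h⟩
      · obtain ⟨ω', h1, h2⟩ := hS2 i (Finset.mem_filter.2 ⟨hi, h⟩)
        exact ⟨ω', Finset.mem_insert_of_mem h1, h2⟩
    · rcases Finset.mem_insert.1 hω' with rfl | h
      · obtain ⟨i, hi⟩ := Finset.card_pos.1 (show 0 < (J.filter (ω' ∈ good ·)).card by omega)
        exact ⟨i, (Finset.mem_filter.1 hi).1, (Finset.mem_filter.1 hi).2⟩
      · obtain ⟨i, hi, h2⟩ := hS3 ω' h
        exact ⟨i, (Finset.mem_filter.1 hi).1, h2⟩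

/-- Markov's inequality for the uniform distribution on a finite type. -/
lemma four_mul_card_filter_le {Ω : Type*} [Fintype Ω] (f : Ω → ℝ) (hf : ∀ ω, 0 ≤ f ω) (B : ℝ)
    (hB : ∑ ω, f ω ≤ Fintype.card Ω * B) [DecidablePred fun ω => 4 * B < f ω] :
    4 * (Finset.univ.filter fun ω => 4 * B < f ω).card ≤ Fintype.card Ω := by
  set s := Finset.univ.filter fun ω => 4 * B < f ω with hs
  rcases s.eq_empty_or_nonempty with h | ⟨ω₀, h₀⟩
  · simp [h]
  have hlt : (s.card : ℝ) * (4 * B) < ∑ ω, f ω := by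
    rw [← nsmul_eq_mul, ← Finset.sum_const]
    refine (Finset.sum_lt_sum_of_nonempty ⟨ω₀, h₀⟩
      fun ω hω => (Finset.mem_filter.1 hω).2).trans_le ?_
    exact Finset.sum_le_sum_of_subset_of_nonneg (Finset.subset_univ s) fun ω _ _ => hf ω
  have hB0 : 0 ≤ B := by
    by_contra hneg
    have := Finset.sum_nonneg fun ω (_ : ω ∈ Finset.univ) => hf ω
    have : (0 : ℝ) < Fintype.card Ω := by exact_mod_cast Fintype.card_pos_iff.2 ⟨ω₀⟩
    nlinarith
  by_contra hcon
  push Not at hcon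
  have : (Fintype.card Ω : ℝ) ≤ 4 * s.card := by exact_mod_cast hcon.le
  nlinarith

/-- Few samples are simultaneously good for one distinguished cost and jointly good for all
others. -/
lemma exists_few_good_samples {Ω ι : Type*} [Fintype Ω] [Nonempty Ω] [Fintype ι]
    (f₀ : Ω → ℝ) (hf₀ : ∀ ω, 0 ≤ f₀ ω) (B₀ : ℝ) (hB₀ : ∑ ω, f₀ ω ≤ Fintype.card Ω * B₀)
    (f : ι → Ω → ℝ) (hf : ∀ i ω, 0 ≤ f i ω) (B : ι → ℝ)
    (hB : ∀ i, ∑ ω, f i ω ≤ Fintype.card Ω * B i) :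
    ∃ S : Finset Ω, (S = ∅ ∨ 2 ^ S.card ≤ 2 * Fintype.card ι) ∧ (∀ ω ∈ S, f₀ ω ≤ 4 * B₀) ∧
      ∀ i, ∃ ω ∈ S, f i ω ≤ 4 * B i := by
  classical
  obtain ⟨S, h1, h2, h3⟩ := exists_small_hitting_set
    (fun i => Finset.univ.filter fun ω => f₀ ω ≤ 4 * B₀ ∧ f i ω ≤ 4 * B i) (fun i => by
      have h0 := four_mul_card_filter_le f₀ hf₀ B₀ hB₀
      have hi := four_mul_card_filter_le (f i) (hf i) (B i) (hB i)
      have hcov : Fintype.card Ω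
          ≤ (Finset.univ.filter fun ω => f₀ ω ≤ 4 * B₀ ∧ f i ω ≤ 4 * B i).card
          + ((Finset.univ.filter fun ω => 4 * B₀ < f₀ ω).card
          + (Finset.univ.filter fun ω => 4 * B i < f i ω).card) := by
        rw [← Finset.card_univ]
        refine (Finset.card_le_card (t := _ ∪ (_ ∪ _)) fun ω _ => ?_).trans
          ((Finset.card_union_le _ _).trans (by gcongr; exact Finset.card_union_le _ _))
        simp only [Finset.mem_union, Finset.mem_filter, Finset.mem_univ, true_and]
        rcases le_or_gt (f₀ ω) (4 * B₀) with h | h <;>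
          rcases le_or_gt (f i ω) (4 * B i) with h' | h' <;> tauto
      omega) (Finset.univ : Finset ι)
  refine ⟨S, h1, fun ω hω => ?_, fun i => ?_⟩
  · obtain ⟨i, -, hi⟩ := h3 ω hω
    exact (Finset.mem_filter.1 hi).2.1
  · obtain ⟨ω, hω, hi⟩ := h2 i (Finset.mem_univ i)
    exact ⟨ω, hω, (Finset.mem_filter.1 hi).2.2⟩
/-- A hierarchy of centers: the center of `u` at level `0` is `u` itself, the center at level
`L` is `r`, the center `r` is absorbing, and consecutive centers are close. -/
structure IsCenterHierarchy {V : Type*} (d : V → V → ℝ) (r : V) (L : ℕ) (c : ℕ → V → V) :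
    Prop where
  zero : ∀ u, c 0 u = u
  top : ∀ u, c L u = r
  absorb : ∀ i u, c i u = r → c (i + 1) u = r
  close : ∀ i u, d (c (i + 1) u) (c i u) ≤ 3 * 2 ^ i

lemma sum_inv_card_le_harmonic {V : Type*} (m : V → ℝ) (s : Finset V) :
    ∑ x ∈ s, ((s.filter fun y => m y ≤ m x).card : ℝ)⁻¹ ≤ (harmonic s.card : ℝ) := by
  classical
  induction s using Finset.strongInduction with
  | H s ih =>
    rcases s.eq_empty_or_nonempty with rfl | hs
    · simp
    obtain ⟨x, hx, hmax⟩ := s.exists_max_image m hs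
    have h1 := ih _ (Finset.erase_ssubset hx)
    have hcard : s.card = (s.erase x).card + 1 := (Finset.card_erase_add_one hx).symm
    rw [← Finset.sum_erase_add _ _ hx, hcard, harmonic_succ]
    push_cast
    refine add_le_add (le_trans (Finset.sum_le_sum fun y hy => ?_) h1) (le_of_eq ?_)
    · have hpos : 0 < ((s.erase x).filter fun z => m z ≤ m y).card :=
        Finset.card_pos.2 ⟨y, Finset.mem_filter.2 ⟨hy, le_rfl⟩⟩
      have hle : ((s.erase x).filter fun z => m z ≤ m y).card
          ≤ (s.filter fun z => m z ≤ m y).card :=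
        Finset.card_le_card (Finset.filter_subset_filter _ (Finset.erase_subset _ _))
      gcongr
    · rw [Finset.filter_true_of_mem fun y hy => hmax y hy, hcard]
      push_cast; rfl

/-- The probability that a fixed element of `S` is first in a uniformly random order. -/
lemma card_mul_card_filter_first {V : Type*} [Fintype V] [DecidableEq V] {n : ℕ}
    (S : Finset V) (x : V) (hx : x ∈ S) :
    S.card * (Finset.univ.filter fun σ : V ≃ Fin n => ∀ y ∈ S, σ x ≤ σ y).card
      ≤ Fintype.card (V ≃ Fin n) := by
  have hsymm : ∀ y ∈ S, (Finset.univ.filter fun σ : V ≃ Fin n => ∀ z ∈ S, σ y ≤ σ z).card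
      = (Finset.univ.filter fun σ : V ≃ Fin n => ∀ z ∈ S, σ x ≤ σ z).card := by
    intro y hy
    have key : ∀ a ∈ S, ∀ b ∈ S, ∀ σ : V ≃ Fin n, (∀ z ∈ S, σ a ≤ σ z) →
        ∀ z ∈ S, ((Equiv.swap a b).trans σ) b ≤ ((Equiv.swap a b).trans σ) z := by
      intro a ha b hb σ h z hz
      simp only [Equiv.trans_apply, Equiv.swap_apply_right]
      apply h
      rw [Equiv.swap_apply_def]
      split_ifs <;> assumption
    refine Finset.card_bij' (fun σ _ => (Equiv.swap y x).trans σ)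
      (fun σ _ => (Equiv.swap x y).trans σ) ?_ ?_ ?_ ?_
    · intro σ h
      exact Finset.mem_filter.2 ⟨Finset.mem_univ _, key y hy x hx σ (Finset.mem_filter.1 h).2⟩
    · intro σ h
      exact Finset.mem_filter.2 ⟨Finset.mem_univ _, key x hx y hy σ (Finset.mem_filter.1 h).2⟩
    · intro σ _; ext z; simp [Equiv.swap_comm x y]
    · intro σ _; ext z; simp [Equiv.swap_comm x y]
  rw [← smul_eq_mul, ← Finset.sum_const, ← Finset.sum_congr rfl hsymm, ← Finset.card_biUnion,
    ← Finset.card_univ]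
  · exact Finset.card_le_card (Finset.subset_univ _)
  · intro a ha b hb hab
    rw [Function.onFun, Finset.disjoint_left]
    intro σ h1 h2
    exact hab (σ.injective (le_antisymm ((Finset.mem_filter.1 h1).2 b hb)
      ((Finset.mem_filter.1 h2).2 a ha)))

/-- The radii at all scales: at each scale the expected number of radii in `[a, b)`, weighted by
the scale, sums to about `b - a`. -/
lemma sum_scales_radius_le (L : ℕ) (a b : ℝ) (hab : a ≤ b) :
    ∑ j : Fin (2 ^ L), ∑ i ∈ Finset.range L,
      (if a ≤ 2 ^ i * (1 + (j : ℝ) / 2 ^ L) / 2 ∧ 2 ^ i * (1 + (j : ℝ) / 2 ^ L) / 2 < b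
        then (2 : ℝ) ^ i else 0) ≤ 2 ^ L * (2 * (b - a) + 1) := by
  rw [Finset.sum_comm]
  have hN : (0 : ℝ) < 2 ^ L := by positivity
  set g : ℝ → ℝ := fun x => max (2 * a) (min x (2 * b + 1)) with hg
  have hmono : Monotone g := fun x y h => max_le_max le_rfl (min_le_min h le_rfl)
  have hinner : ∀ i ∈ Finset.range L, ∑ j : Fin (2 ^ L),
      (if a ≤ 2 ^ i * (1 + (j : ℝ) / 2 ^ L) / 2 ∧ 2 ^ i * (1 + (j : ℝ) / 2 ^ L) / 2 < b
        then (2 : ℝ) ^ i else 0) ≤ 2 ^ L * (g (2 ^ (i + 1)) - g (2 ^ i)) := by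
    intro i hi
    have hiL : (2 : ℝ) ^ i / 2 ^ L ≤ 1 := by
      rw [div_le_one hN]
      exact pow_le_pow_right₀ one_le_two (Finset.mem_range.1 hi).le
    have hi0 : (0 : ℝ) ≤ 2 ^ i / 2 ^ L := by positivity
    rw [Fin.sum_univ_eq_sum_range (fun j => if a ≤ 2 ^ i * (1 + (j : ℝ) / 2 ^ L) / 2 ∧
      2 ^ i * (1 + (j : ℝ) / 2 ^ L) / 2 < b then (2 : ℝ) ^ i else 0)]
    have htel := Finset.sum_range_sub (fun j : ℕ => g (2 ^ i * (1 + (j : ℝ) / 2 ^ L))) (2 ^ L)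
    have hend : (2 : ℝ) ^ i * (1 + ((2 ^ L : ℕ) : ℝ) / 2 ^ L) = 2 ^ (i + 1) := by
      push_cast; rw [div_self hN.ne', pow_succ]; ring
    simp only [hend, Nat.cast_zero, zero_div, add_zero, mul_one] at htel
    rw [← htel, Finset.mul_sum]
    refine Finset.sum_le_sum fun j _ => ?_
    have hstep : (2 : ℝ) ^ i * (1 + ((j + 1 : ℕ) : ℝ) / 2 ^ L)
        = 2 ^ i * (1 + (j : ℝ) / 2 ^ L) + 2 ^ i / 2 ^ L := by
      push_cast; ring
    split_ifs with h
    · have e1 : g (2 ^ i * (1 + (j : ℝ) / 2 ^ L)) = 2 ^ i * (1 + (j : ℝ) / 2 ^ L) := by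
        rw [hg]; simp only
        rw [min_eq_left (by linarith), max_eq_right (by linarith)]
      have e2 : g (2 ^ i * (1 + ((j + 1 : ℕ) : ℝ) / 2 ^ L))
          = 2 ^ i * (1 + (j : ℝ) / 2 ^ L) + 2 ^ i / 2 ^ L := by
        rw [hstep, hg]; simp only
        rw [min_eq_left (by linarith), max_eq_right (by linarith)]
      rw [e1, e2, add_sub_cancel_left, mul_div_cancel₀ _ hN.ne']
    · refine mul_nonneg hN.le (sub_nonneg.2 (hmono ?_))
      rw [hstep]; linarith
  refine (Finset.sum_le_sum hinner).trans ?_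
  rw [← Finset.mul_sum, Finset.sum_range_sub (fun i => g (2 ^ i))]
  refine mul_le_mul_of_nonneg_left ?_ hN.le
  have h1 : g (2 ^ L) ≤ 2 * b + 1 := max_le (by linarith) (min_le_right _ _)
  have h2 : 2 * a ≤ g (2 ^ 0) := le_max_left _ _
  linarith

/-- Random low-diameter hierarchies in which nearby points are rarely separated. -/
lemma exists_centerHierarchies {V : Type} [Fintype V] [DecidableEq V] (d : V → V → ℝ)
    (hd : IsUnitSeparatedMetric d) (r : V) :
    ∃ (L : ℕ) (Ω : Type) (_ : Fintype Ω) (_ : Nonempty Ω) (c : Ω → ℕ → V → V),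
      (∀ ω, IsCenterHierarchy d r L (c ω)) ∧
      ∀ u v, ∑ ω, ∑ i ∈ (Finset.range L).filter (fun i => c ω i u ≠ c ω i v), (2 : ℝ) ^ i
        ≤ Fintype.card Ω * (3 * (2 + Real.log (Fintype.card V)) * d u v) := by
  classical
  obtain ⟨D, hD⟩ : ∃ D : ℝ, ∀ u, d u r ≤ D := by
    obtain ⟨D, hD⟩ := (Set.finite_range fun u => d u r).bddAbove
    exact ⟨D, fun u => hD ⟨u, rfl⟩⟩
  obtain ⟨L, hL⟩ := pow_unbounded_of_one_lt (2 * D) (one_lt_two (α := ℝ))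
  set n := Fintype.card V with hn
  have : Nonempty (V ≃ Fin n) := ⟨Fintype.equivFin V⟩
  have hN : (0 : ℝ) < 2 ^ L := by positivity
  set R : Fin (2 ^ L) → ℕ → ℝ := fun j i => 2 ^ i * (1 + (j : ℝ) / 2 ^ L) / 2 with hR
  have hj : ∀ j : Fin (2 ^ L), 0 ≤ (j : ℝ) / 2 ^ L ∧ (j : ℝ) / 2 ^ L < 1 := fun j =>
    ⟨by positivity, (div_lt_one hN).2 (by exact_mod_cast j.2)⟩
  have hRpos : ∀ j i, 0 ≤ R j i := fun j i => by
    have := (hj j).1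
    simp only [hR]; positivity
  have hex : ∀ ω : (V ≃ Fin n) × Fin (2 ^ L), ∀ i u, ∃ x, d u x ≤ R ω.2 i ∧
      (d u r ≤ R ω.2 i → x = r) ∧ (¬ d u r ≤ R ω.2 i → ∀ y, d u y ≤ R ω.2 i → ω.1 x ≤ ω.1 y) := by
    intro ω i u
    by_cases h : d u r ≤ R ω.2 i
    · exact ⟨r, h, fun _ => rfl, fun h' => absurd h h'⟩
    · obtain ⟨x, hx, hmin⟩ := (Finset.univ.filter fun x => d u x ≤ R ω.2 i).exists_min_image ω.1
        ⟨u, by simp [hd.self, hRpos]⟩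
      exact ⟨x, (Finset.mem_filter.1 hx).2, fun h' => absurd h' h,
        fun _ y hy => hmin y (Finset.mem_filter.2 ⟨Finset.mem_univ _, hy⟩)⟩
  choose c hc1 hc2 hc3 using hex
  refine ⟨L, (V ≃ Fin n) × Fin (2 ^ L), inferInstance, inferInstance, c, fun ω => ⟨fun u => ?_,
    fun u => ?_, fun i u h => ?_, fun i u => ?_⟩, fun u v => ?_⟩
  · by_contra hne
    have h1 := hd.one_le _ _ (Ne.symm hne)
    have h2 := hc1 ω 0 u
    have h3 := (hj ω.2).2
    simp only [hR, pow_zero] at h2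
    linarith
  · apply hc2
    refine (hD u).trans ?_
    have h3 := (hj ω.2).1
    simp only [hR]
    nlinarith
  · apply hc2
    have h1 := hc1 ω i u
    have h2 := hRpos ω.2 i
    rw [h] at h1
    refine h1.trans ?_
    simp only [hR] at h2 ⊢
    rw [pow_succ]; linarith
  · have h1 := hc1 ω i u
    have h2 := hc1 ω (i + 1) u
    have h3 := hd.triangle (c ω (i + 1) u) u (c ω i u)
    rw [hd.symm _ u] at h3
    have h4 := (hj ω.2).2
    have h5 : (0 : ℝ) < 2 ^ i := by positivity
    simp only [hR, pow_succ] at h1 h2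
    nlinarith
  by_cases huv : u = v
  · subst huv; simp [hd.self]
  have hduv := hd.one_le u v huv
  set lo : V → ℝ := fun x => min (d u x) (d v x) with hlo
  set hi : V → ℝ := fun x => max (d u x) (d v x) with hhi
  have hlohi : ∀ x, lo x ≤ hi x := fun x => min_le_max
  have hgap : ∀ x, hi x - lo x ≤ d u v := by
    intro x
    have h1 := hd.triangle u v x
    have h2 := hd.triangle v u x
    rw [hd.symm v u] at h2
    simp only [hlo, hhi]
    rcases le_total (d u x) (d v x) with h | h
    · rw [max_eq_right h, min_eq_left h]; linarith
    · rw [max_eq_left h, min_eq_right h]; linarith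
  set first : V → (V ≃ Fin n) → Prop := fun x σ =>
    ∀ y ∈ Finset.univ.filter (fun y => lo y ≤ lo x), σ x ≤ σ y with hfirst
  set A : V → Fin (2 ^ L) → ℕ → ℝ := fun x j i =>
    if lo x ≤ R j i ∧ R j i < hi x then (2 : ℝ) ^ i else 0 with hA
  have hA0 : ∀ x j i, 0 ≤ A x j i := fun x j i => by
    simp only [hA]; split_ifs <;> positivity
  have hAsum : ∀ x, ∑ j, ∑ i ∈ Finset.range L, A x j i ≤ 2 ^ L * (3 * d u v) := fun x =>
    (sum_scales_radius_le L (lo x) (hi x) (hlohi x)).trans (by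
      have := hgap x
      gcongr
      linarith)
  have hcut : ∀ ω : (V ≃ Fin n) × Fin (2 ^ L), ∀ i, c ω i u ≠ c ω i v →
      (2 : ℝ) ^ i ≤ A r ω.2 i + ∑ x, if first x ω.1 then A x ω.2 i else 0 := by
    intro ω i hne
    have hAeq : ∀ x, lo x ≤ R ω.2 i → R ω.2 i < hi x → A x ω.2 i = 2 ^ i := fun x h1 h2 =>
      if_pos ⟨h1, h2⟩
    have hsum0 : ∀ x ∈ Finset.univ, 0 ≤ if first x ω.1 then A x ω.2 i else 0 := fun x _ => by
      split_ifs
      · exact hA0 _ _ _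
      · exact le_rfl
    by_cases h : lo r ≤ R ω.2 i
    · by_cases h' : R ω.2 i < hi r
      · rw [hAeq r h h']
        exact le_add_of_nonneg_right (Finset.sum_nonneg hsum0)
      · exfalso
        simp only [hhi, not_lt, max_le_iff] at h'
        exact hne ((hc2 ω i u h'.1).trans (hc2 ω i v h'.2).symm)
    · simp only [hlo, min_le_iff, not_or] at h
      obtain ⟨x, hx, hmin⟩ := (Finset.univ.filter fun x => lo x ≤ R ω.2 i).exists_min_image ω.1
        ⟨u, by simp [hlo, hd.self, hRpos]⟩
      have hx := (Finset.mem_filter.1 hx).2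
      have hmin : ∀ y, lo y ≤ R ω.2 i → ω.1 x ≤ ω.1 y := fun y hy =>
        hmin y (Finset.mem_filter.2 ⟨Finset.mem_univ _, hy⟩)
      have hfx : first x ω.1 := fun y hy => hmin y ((Finset.mem_filter.1 hy).2.trans hx)
      have hcu : d u x ≤ R ω.2 i → c ω i u = x := fun h1 => ω.1.injective
        (le_antisymm (hc3 ω i u h.1 x h1) (hmin _ ((min_le_left _ _).trans (hc1 ω i u))))
      have hcv : d v x ≤ R ω.2 i → c ω i v = x := fun h1 => ω.1.injective
        (le_antisymm (hc3 ω i v h.2 x h1) (hmin _ ((min_le_right _ _).trans (hc1 ω i v))))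
      have hx' : R ω.2 i < hi x := by
        by_contra h'
        simp only [hhi, not_lt, max_le_iff] at h'
        exact hne ((hcu h'.1).trans (hcv h'.2).symm)
      have h2 := Finset.single_le_sum hsum0 (Finset.mem_univ x)
      rw [if_pos hfx, hAeq x hx hx'] at h2
      exact h2.trans (le_add_of_nonneg_left (hA0 _ _ _))
  have hprob : ∀ x, ∑ σ : V ≃ Fin n, (if first x σ then (1 : ℝ) else 0)
      ≤ Fintype.card (V ≃ Fin n) * ((Finset.univ.filter fun y => lo y ≤ lo x).card : ℝ)⁻¹ := by
    intro x
    have hxm : x ∈ Finset.univ.filter (fun y => lo y ≤ lo x) := by simp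
    have h1 := card_mul_card_filter_first (n := n) _ x hxm
    have hpos : (0 : ℝ) < (Finset.univ.filter fun y => lo y ≤ lo x).card := by
      exact_mod_cast Finset.card_pos.2 ⟨x, hxm⟩
    rw [Finset.sum_boole, ← div_eq_mul_inv, le_div_iff₀ hpos, mul_comm]
    exact_mod_cast h1
  have hharm : ∑ x, ((Finset.univ.filter fun y => lo y ≤ lo x).card : ℝ)⁻¹ ≤ 1 + Real.log n :=
    (sum_inv_card_le_harmonic lo Finset.univ).trans (by
      rw [Finset.card_univ]; exact harmonic_le_one_add_log _)
  calc ∑ ω, ∑ i ∈ (Finset.range L).filter (fun i => c ω i u ≠ c ω i v), (2 : ℝ) ^ i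
      ≤ ∑ ω : (V ≃ Fin n) × Fin (2 ^ L), ∑ i ∈ Finset.range L,
          (A r ω.2 i + ∑ x, if first x ω.1 then A x ω.2 i else 0) := by
        refine Finset.sum_le_sum fun ω _ => ?_
        rw [Finset.sum_filter]
        refine Finset.sum_le_sum fun i _ => ?_
        split_ifs with h
        · exact hcut ω i h
        · refine add_nonneg (hA0 _ _ _) (Finset.sum_nonneg fun x _ => ?_)
          split_ifs
          · exact hA0 _ _ _
          · exact le_rfl
    _ = ∑ σ : V ≃ Fin n, (∑ j, ∑ i ∈ Finset.range L, A r j i)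
          + ∑ x, (∑ σ : V ≃ Fin n, if first x σ then (1 : ℝ) else 0) *
            (∑ j, ∑ i ∈ Finset.range L, A x j i) := by
        rw [Fintype.sum_prod_type]
        simp only [Finset.sum_add_distrib]
        congr 1
        have hx : ∀ x, (∑ σ : V ≃ Fin n, if first x σ then (1 : ℝ) else 0) *
            (∑ j, ∑ i ∈ Finset.range L, A x j i) =
            ∑ σ, ∑ j, ∑ i ∈ Finset.range L, if first x σ then A x j i else 0 := fun x => by
          rw [Finset.sum_mul]
          refine Finset.sum_congr rfl fun σ _ => ?_
          simp only [Finset.mul_sum, ite_mul, one_mul, zero_mul]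
        simp only [hx]
        rw [Finset.sum_comm (s := (Finset.univ : Finset V))]
        refine Finset.sum_congr rfl fun σ _ => ?_
        rw [Finset.sum_comm (s := (Finset.univ : Finset V))]
        refine Finset.sum_congr rfl fun j _ => ?_
        rw [Finset.sum_comm]
    _ ≤ Fintype.card (V ≃ Fin n) * (2 ^ L * (3 * d u v))
          + ∑ x, (Fintype.card (V ≃ Fin n) *
            ((Finset.univ.filter fun y => lo y ≤ lo x).card : ℝ)⁻¹) * (2 ^ L * (3 * d u v)) := by
        rw [Finset.sum_const, Finset.card_univ, nsmul_eq_mul]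
        refine add_le_add (mul_le_mul_of_nonneg_left (hAsum r) (Nat.cast_nonneg _))
          (Finset.sum_le_sum fun x _ => mul_le_mul (hprob x) (hAsum x) ?_ (by positivity))
        exact Finset.sum_nonneg fun j _ => Finset.sum_nonneg fun i _ => hA0 _ _ _
    _ ≤ Fintype.card (V ≃ Fin n) * (2 ^ L * (3 * d u v))
          + (Fintype.card (V ≃ Fin n) * (1 + Real.log n)) * (2 ^ L * (3 * d u v)) := by
        rw [← Finset.sum_mul, ← Finset.mul_sum]
        have : 0 ≤ d u v := zero_le_one.trans hduv
        gcongr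
    _ = Fintype.card ((V ≃ Fin n) × Fin (2 ^ L)) * (3 * (2 + Real.log n) * d u v) := by
        rw [Fintype.card_prod, Fintype.card_fin]
        push_cast; ring
/-- The graph joining every vertex other than the root to its parent. -/
def parentGraph {N : Type*} (root : N) (parent : N → N) : SimpleGraph N :=
  SimpleGraph.fromEdgeSet {e | ∃ x, x ≠ root ∧ e = s(x, parent x)}

section ParentGraph

variable {N : Type*} {root : N} {parent : N → N} {depth : N → ℕ}

lemma parent_edge_injective (hdepth : ∀ x, x ≠ root → depth x = depth (parent x) + 1) {x y : N}
    (hx : x ≠ root) (hy : y ≠ root) (h : s(x, parent x) = s(y, parent y)) : x = y := by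
  rcases Sym2.eq_iff.1 h with ⟨h, -⟩ | ⟨h1, h2⟩
  · exact h
  · have := hdepth x hx
    have := hdepth y hy
    rw [h2] at *
    rw [← h1] at *
    omega

lemma edgeSet_parentGraph (hdepth : ∀ x, x ≠ root → depth x = depth (parent x) + 1) :
    (parentGraph root parent).edgeSet = {e | ∃ x, x ≠ root ∧ e = s(x, parent x)} := by
  rw [parentGraph, SimpleGraph.edgeSet_fromEdgeSet, sdiff_eq_left, Set.disjoint_left]
  rintro e ⟨x, hx, rfl⟩ h
  have h1 := hdepth x hx
  have h2 : x = parent x := by simpa using h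
  rw [← h2] at h1
  omega

lemma parentGraph_adj (hdepth : ∀ x, x ≠ root → depth x = depth (parent x) + 1) {a b : N} :
    (parentGraph root parent).Adj a b ↔ (a ≠ root ∧ b = parent a) ∨ (b ≠ root ∧ a = parent b) := by
  rw [← SimpleGraph.mem_edgeSet, edgeSet_parentGraph hdepth]
  constructor
  · rintro ⟨x, hx, h⟩
    rcases Sym2.eq_iff.1 h with ⟨rfl, rfl⟩ | ⟨rfl, rfl⟩
    · exact Or.inl ⟨hx, rfl⟩
    · exact Or.inr ⟨hx, rfl⟩
  · rintro (⟨h, rfl⟩ | ⟨h, rfl⟩)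
    · exact ⟨a, h, rfl⟩
    · exact ⟨b, h, Sym2.eq_swap⟩

lemma exists_walk_length_eq_depth (hroot : depth root = 0)
    (hdepth : ∀ x, x ≠ root → depth x = depth (parent x) + 1) (x : N) :
    ∃ p : (parentGraph root parent).Walk root x, p.length = depth x := by
  induction hk : depth x generalizing x with
  | zero =>
    have hx : x = root := by
      by_contra h
      have := hdepth x h
      omega
    subst hx
    exact ⟨SimpleGraph.Walk.nil, rfl⟩
  | succ k ih =>
    have hx : x ≠ root := by
      rintro rfl
      omega
    have h1 := hdepth x hx
    obtain ⟨p, hp⟩ := ih (parent x) (by omega)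
    refine ⟨p.concat ((parentGraph_adj hdepth).2 (Or.inr ⟨hx, rfl⟩)), ?_⟩
    rw [SimpleGraph.Walk.length_concat, hp]

lemma connected_parentGraph (hroot : depth root = 0)
    (hdepth : ∀ x, x ≠ root → depth x = depth (parent x) + 1) :
    (parentGraph root parent).Connected := by
  have : Nonempty N := ⟨root⟩
  refine SimpleGraph.Connected.mk fun x y => ?_
  obtain ⟨p, -⟩ := exists_walk_length_eq_depth hroot hdepth x
  obtain ⟨q, -⟩ := exists_walk_length_eq_depth hroot hdepth y
  exact p.reachable.symm.trans q.reachable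

lemma dist_parentGraph (hroot : depth root = 0)
    (hdepth : ∀ x, x ≠ root → depth x = depth (parent x) + 1) (x : N) :
    (parentGraph root parent).dist root x = depth x := by
  refine le_antisymm ?_ ?_
  · obtain ⟨p, hp⟩ := exists_walk_length_eq_depth hroot hdepth x
    exact hp ▸ SimpleGraph.dist_le p
  · obtain ⟨p, hp⟩ := (connected_parentGraph hroot hdepth).exists_walk_length_eq_dist root x
    have key : ∀ {a b : N} (p : (parentGraph root parent).Walk a b),
        depth b ≤ depth a + p.length := by
      intro a b p
      induction p with
      | nil => simp
      | cons h p ih =>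
        rw [SimpleGraph.Walk.length_cons]
        rcases (parentGraph_adj hdepth).1 h with ⟨hne, rfl⟩ | ⟨hne, rfl⟩ <;>
        · have := hdepth _ hne
          omega
    have := key p
    omega

lemma isTree_parentGraph [Finite N] (hroot : depth root = 0)
    (hdepth : ∀ x, x ≠ root → depth x = depth (parent x) + 1) :
    (parentGraph root parent).IsTree := by
  classical
  have := Fintype.ofFinite N
  refine SimpleGraph.isTree_iff_connected_and_card.2 ⟨connected_parentGraph hroot hdepth, ?_⟩
  have himg : (parentGraph root parent).edgeSet
      = ((Finset.univ.erase root).image fun x => s(x, parent x) : Finset (Sym2 N)) := by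
    rw [edgeSet_parentGraph hdepth]
    ext e
    simp [eq_comm]
  rw [himg, Nat.card_coe_set_eq, Set.ncard_coe_finset, Finset.card_image_of_injOn
    fun x hx y hy h => parent_edge_injective hdepth (by simpa using hx) (by simpa using hy) h,
    Finset.card_erase_add_one (Finset.mem_univ _), Nat.card_eq_fintype_card, Finset.card_univ]

open Classical in
/-- The lower endpoint of an edge of a parent graph (the root for other pairs). -/
noncomputable def lowerEnd (root : N) (parent : N → N) (e : Sym2 N) : N :=
  if h : ∃ x, x ≠ root ∧ e = s(x, parent x) then h.choose else root

lemma lowerEnd_parent_edge (hdepth : ∀ x, x ≠ root → depth x = depth (parent x) + 1) {x : N}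
    (hx : x ≠ root) : lowerEnd root parent s(x, parent x) = x := by
  have h : ∃ y, y ≠ root ∧ s(x, parent x) = s(y, parent y) := ⟨x, hx, rfl⟩
  rw [lowerEnd, dif_pos h]
  exact (parent_edge_injective hdepth hx h.choose_spec.1 h.choose_spec.2).symm

lemma wellSeparated_parentGraph (hroot : depth root = 0)
    (hdepth : ∀ x, x ≠ root → depth x = depth (parent x) + 1) (wt : N → ℝ)
    (hwt : ∀ x, x ≠ root → parent x ≠ root → wt x ≤ wt (parent x) / 2) :
    WellSeparated (parentGraph root parent) root fun e => wt (lowerEnd root parent e) := by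
  intro a b c hab hbc h1 h2
  simp only [dist_parentGraph hroot hdepth] at h1 h2
  have up : ∀ {x y : N}, (parentGraph root parent).Adj x y → depth y = depth x + 1 →
      y ≠ root ∧ x = parent y := by
    intro x y h hd
    rcases (parentGraph_adj hdepth).1 h with ⟨hne, rfl⟩ | hne
    · have := hdepth x hne
      omega
    · exact hne
  obtain ⟨hb, rfl⟩ := up hab h1
  obtain ⟨hc, rfl⟩ := up hbc h2
  simp only
  rw [Sym2.eq_swap, lowerEnd_parent_edge hdepth hc, Sym2.eq_swap, lowerEnd_parent_edge hdepth hb]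
  exact hwt c hc hb

end ParentGraph

/-- The vertex that a node of the tree of center sequences is a copy of. -/
def nodeLabel {V : Type*} (r : V) : List (V × ℕ) → V
  | [] => r
  | x :: _ => x.1

/-- Sequences of centers, listed from the finest scale to the coarsest one, with strictly
monotone scales below `L` and consecutive centers close with respect to their scale. -/
def IsCenterSequence {V : Type*} (d : V → V → ℝ) (r : V) (L : ℕ) : List (V × ℕ) → Prop
  | [] => True
  | x :: l => x.1 ≠ r ∧ x.2 < L ∧ d (nodeLabel r l) x.1 ≤ 3 * 2 ^ x.2 ∧
      (∀ y ∈ l.head?, x.2 < y.2) ∧ IsCenterSequence d r L l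

/-- The nodes of the universal copy tree. -/
def CenterNode {V : Type*} (d : V → V → ℝ) (r : V) (L : ℕ) : Type _ :=
  {l : List (V × ℕ) // IsCenterSequence d r L l}

namespace CenterNode

variable {V : Type*} {d : V → V → ℝ} {r : V} {L : ℕ}

lemma length_add_le (x : V × ℕ) (l : List (V × ℕ)) (h : IsCenterSequence d r L (x :: l)) :
    (x :: l).length + x.2 ≤ L := by
  induction l generalizing x with
  | nil => have := h.2.1; simp only [List.length_singleton]; omega
  | cons y l ih =>
    have h1 := ih y h.2.2.2.2
    have h2 := h.2.2.2.1 y rfl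
    simp only [List.length_cons] at *
    omega

lemma snd_lt (l : List (V × ℕ)) (h : IsCenterSequence d r L l) : ∀ x ∈ l, x.2 < L := by
  induction l with
  | nil => simp
  | cons y l ih =>
    intro x hx
    rcases List.mem_cons.1 hx with rfl | hx
    · exact h.2.1
    · exact ih h.2.2.2.2 x hx

instance [Finite V] : Finite (CenterNode d r L) := by
  have hfin := List.finite_length_le (V × Fin L) L
  refine Set.Finite.to_subtype ((hfin.image (List.map fun x => (x.1, (x.2 : ℕ)))).subset ?_)
  intro l hl
  refine ⟨l.attach.map fun x => (x.1.1, ⟨x.1.2, snd_lt l hl x.1 x.2⟩), ?_, ?_⟩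
  · simp only [Set.mem_ofPred_eq, List.length_map, List.length_attach]
    cases l with
    | nil => simp
    | cons x l => have := length_add_le x l hl; omega
  · rw [List.map_map]
    exact List.attach_map_subtype_val l

/-- The empty center sequence. -/
def root : CenterNode d r L := ⟨[], trivial⟩

/-- Forget the finest center. -/
def parent (x : CenterNode d r L) : CenterNode d r L :=
  ⟨x.1.tail, by
    obtain ⟨l, hl⟩ := x
    cases l with
    | nil => trivial
    | cons y l => exact hl.2.2.2.2⟩

/-- The vertex of which a node is a copy. -/
def label (x : CenterNode d r L) : V := nodeLabel r x.1

/-- The weight of the edge between a node and its parent. -/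
def weight (x : CenterNode d r L) : ℝ := (x.1.head?).elim 0 fun y => 3 * 2 ^ y.2

/-- The length of a center sequence. -/
def depth (x : CenterNode d r L) : ℕ := x.1.length

lemma depth_root : depth (root : CenterNode d r L) = 0 := rfl

lemma depth_eq (x : CenterNode d r L) (hx : x ≠ root) : depth x = depth (parent x) + 1 := by
  obtain ⟨l, hl⟩ := x
  cases l with
  | nil => exact absurd rfl hx
  | cons y l => rfl

lemma weight_nonneg (x : CenterNode d r L) : 0 ≤ weight x := by
  obtain ⟨l, hl⟩ := x
  cases l with
  | nil => exact le_rfl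
  | cons y l => simp only [weight, List.head?_cons, Option.elim_some]; positivity

lemma weight_le_half (x : CenterNode d r L) (hx : x ≠ root) (hpx : parent x ≠ root) :
    weight x ≤ weight (parent x) / 2 := by
  obtain ⟨l, hl⟩ := x
  match l, hl with
  | [], hl => exact absurd rfl hx
  | [y], hl => exact absurd rfl hpx
  | y :: z :: l, hl =>
    have h := hl.2.2.2.1 z rfl
    have h2 : (2 : ℝ) ^ (y.2 + 1) ≤ 2 ^ z.2 := pow_le_pow_right₀ one_le_two h
    rw [pow_succ] at h2
    simp only [weight, parent, List.head?_cons, Option.elim_some, List.tail_cons]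
    linarith

lemma label_eq_iff (x : CenterNode d r L) : label x = r ↔ x = root := by
  obtain ⟨l, hl⟩ := x
  cases l with
  | nil => exact ⟨fun _ => rfl, fun _ => rfl⟩
  | cons y l => exact ⟨fun h => absurd h hl.1,
      fun h => absurd (congrArg Subtype.val h) (by simp [root])⟩

lemma dist_label_parent_le (x : CenterNode d r L) (hx : x ≠ root) :
    d (label (parent x)) (label x) ≤ weight x := by
  obtain ⟨l, hl⟩ := x
  cases l with
  | nil => exact absurd rfl hx
  | cons y l => exact hl.2.2.1

end CenterNode

open Classical in
/-- The center sequence of `u` with scales `i, …, i + k - 1`. -/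
noncomputable def centerChain {V : Type*} (r : V) (c : ℕ → V → V) (u : V) : ℕ → ℕ → List (V × ℕ)
  | 0, _ => []
  | k + 1, i => if c i u = r then [] else (c i u, i) :: centerChain r c u k (i + 1)

section CenterChain

variable {V : Type*} {d : V → V → ℝ} {r : V} {L : ℕ} {c : ℕ → V → V}

lemma nodeLabel_centerChain (hc : IsCenterHierarchy d r L c) (u : V) (k i : ℕ) (hk : i + k = L) :
    nodeLabel r (centerChain r c u k i) = c i u := by
  cases k with
  | zero => rw [add_zero] at hk; rw [hk, hc.top]; rfl
  | succ k =>
    rw [centerChain]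
    split_ifs with h
    · exact h.symm
    · rfl

lemma isCenterSequence_centerChain (hc : IsCenterHierarchy d r L c) (u : V) (k i : ℕ)
    (hk : i + k = L) : IsCenterSequence d r L (centerChain r c u k i) := by
  induction k generalizing i with
  | zero => trivial
  | succ k ih =>
    rw [centerChain]
    split_ifs with h
    · trivial
    · refine ⟨h, by simp only; omega, ?_, ?_, ih _ (by omega)⟩
      · rw [nodeLabel_centerChain hc u k (i + 1) (by omega)]
        exact hc.close i u
      · cases k with
        | zero => simp [centerChain]
        | succ k =>
          rw [centerChain]
          split_ifs <;> simp

/-- The node of the center sequence of `u` from scale `i` upwards. -/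
noncomputable def chainNode (hc : IsCenterHierarchy d r L c) (u : V) (k i : ℕ) (hk : i + k = L) :
    CenterNode d r L :=
  ⟨centerChain r c u k i, isCenterSequence_centerChain hc u k i hk⟩

lemma exists_connecting_parent_edge (hc : IsCenterHierarchy d r L c) (u : V) (k i : ℕ)
    (hk : i + (k + 1) = L) :
    ∃ F : Finset (Sym2 (CenterNode d r L)),
      (F : Set (Sym2 (CenterNode d r L))) ⊆
        (parentGraph CenterNode.root CenterNode.parent).edgeSet ∧
      EdgeConn (F : Set (Sym2 (CenterNode d r L))) (chainNode hc u (k + 1) i hk)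
        (chainNode hc u k (i + 1) (by omega)) ∧
      ∑ e ∈ F, (lowerEnd CenterNode.root CenterNode.parent e).weight ≤ 3 * 2 ^ i := by
  by_cases h : c i u = r
  · refine ⟨∅, by simp, ?_, by simp⟩
    have : chainNode hc u (k + 1) i hk = chainNode hc u k (i + 1) (by omega) := by
      refine Subtype.ext ?_
      simp only [chainNode]
      rw [centerChain, if_pos h]
      cases k with
      | zero => rfl
      | succ k => rw [centerChain, if_pos (hc.absorb i u h)]
    rw [this]
    exact SimpleGraph.Reachable.refl _
  · have hval : (chainNode hc u (k + 1) i hk).1 = (c i u, i) :: centerChain r c u k (i + 1) := by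
      simp only [chainNode]
      rw [centerChain, if_neg h]
    have hpar : (chainNode hc u (k + 1) i hk).parent = chainNode hc u k (i + 1) (by omega) :=
      Subtype.ext (by rw [CenterNode.parent]; simp only [hval]; rfl)
    have hne : chainNode hc u (k + 1) i hk ≠ CenterNode.root := fun h' => by
      have := congrArg Subtype.val h'
      rw [hval] at this
      simp [CenterNode.root] at this
    refine ⟨{s(chainNode hc u (k + 1) i hk, (chainNode hc u (k + 1) i hk).parent)}, ?_, ?_, ?_⟩
    · rw [edgeSet_parentGraph CenterNode.depth_eq, Finset.coe_singleton,
        Set.singleton_subset_iff]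
      exact ⟨_, hne, rfl⟩
    · exact EdgeConn.of_mem (by rw [hpar]; simp)
    · rw [Finset.sum_singleton, lowerEnd_parent_edge CenterNode.depth_eq hne, CenterNode.weight,
        hval]
      simp

lemma exists_connecting_tree_edges [DecidableEq V] (hc : IsCenterHierarchy d r L c)
    (u v : V) (k i : ℕ) (hk : i + k = L) :
    ∃ F : Finset (Sym2 (CenterNode d r L)),
      (F : Set (Sym2 (CenterNode d r L))) ⊆
        (parentGraph CenterNode.root CenterNode.parent).edgeSet ∧
      EdgeConn (F : Set (Sym2 (CenterNode d r L))) (chainNode hc u k i hk)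
        (chainNode hc v k i hk) ∧
      ((F = ∅ ∧ chainNode hc u k i hk = chainNode hc v k i hk) ∨
        ∑ e ∈ F, (lowerEnd CenterNode.root CenterNode.parent e).weight ≤
          12 * ∑ j ∈ (Finset.Ico i L).filter (fun j => c j u ≠ c j v), (2 : ℝ) ^ j - 6 * 2 ^ i) := by
  classical
  induction k generalizing i with
  | zero => exact ⟨∅, by simp, SimpleGraph.Reachable.refl _, Or.inl ⟨rfl, rfl⟩⟩
  | succ k ih =>
    obtain ⟨F, hF, hFc, hFw⟩ := ih (i + 1) (by omega)
    by_cases hcase : F = ∅ ∧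
      chainNode hc u k (i + 1) (by omega) = chainNode hc v k (i + 1) (by omega) ∧ c i u = c i v
    · have heq : chainNode hc u (k + 1) i hk = chainNode hc v (k + 1) i hk := by
        refine Subtype.ext ?_
        have := congrArg Subtype.val hcase.2.1
        simp only [chainNode] at this ⊢
        rw [centerChain, centerChain, this, hcase.2.2]
      exact ⟨∅, by simp, heq ▸ SimpleGraph.Reachable.refl _, Or.inl ⟨rfl, heq⟩⟩
    obtain ⟨Fu, hFu, hFuc, hFuw⟩ := exists_connecting_parent_edge hc u k i hk
    obtain ⟨Fv, hFv, hFvc, hFvw⟩ := exists_connecting_parent_edge hc v k i hk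
    refine ⟨Fu ∪ F ∪ Fv, ?_, ?_, Or.inr ?_⟩
    · simp only [Finset.coe_union]
      exact Set.union_subset (Set.union_subset hFu hF) hFv
    · simp only [Finset.coe_union]
      exact ((hFuc.mono (by intro e he; simp only [Set.mem_union]; tauto)).trans
        (hFc.mono (by intro e he; simp only [Set.mem_union]; tauto))).trans
        (EdgeConn.mono (by intro e he; simp only [Set.mem_union]; tauto) hFvc.symm)
    · set W : Finset (Sym2 (CenterNode d r L)) → ℝ := fun F =>
        ∑ e ∈ F, (lowerEnd CenterNode.root CenterNode.parent e).weight with hW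
      have hunion : ∀ A B, W (A ∪ B) ≤ W A + W B := fun A B => by
        simp only [hW]
        rw [← Finset.sum_union_inter]
        exact le_add_of_nonneg_right (Finset.sum_nonneg fun e _ => CenterNode.weight_nonneg _)
      have h1 := hunion (Fu ∪ F) Fv
      have h2 := hunion Fu F
      change W (Fu ∪ F ∪ Fv) ≤ _
      change W Fu ≤ _ at hFuw
      change W Fv ≤ _ at hFvw
      have hIco : Finset.Ico i L = insert i (Finset.Ico (i + 1) L) :=
        (Finset.insert_Ico_add_one_left_eq_Ico (by omega)).symm
      have hpow : (0 : ℝ) < 2 ^ i := by positivity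
      have hD : 0 ≤ ∑ j ∈ (Finset.Ico (i + 1) L).filter (fun j => c j u ≠ c j v), (2 : ℝ) ^ j :=
        Finset.sum_nonneg fun j _ => by positivity
      rw [hIco, Finset.filter_insert]
      by_cases hi : c i u = c i v
      · rw [if_neg (by simpa using hi)]
        rcases hFw with ⟨hF0, hFe⟩ | hFw
        · exact absurd ⟨hF0, hFe, hi⟩ hcase
        · change W F ≤ _ at hFw
          rw [pow_succ] at hFw
          linarith
      · rw [if_pos hi, Finset.sum_insert (by simp)]
        rcases hFw with ⟨hF0, -⟩ | hFw
        · have : W F = 0 := by rw [hF0]; simp [hW]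
          linarith
        · change W F ≤ _ at hFw
          rw [pow_succ] at hFw
          linarith

end CenterChain

lemma sum_biUnion_le {α β : Type*} [DecidableEq β] (s : Finset α) (t : α → Finset β) (f : β → ℝ)
    (hf : ∀ a ∈ s, ∀ b ∈ t a, 0 ≤ f b) : ∑ b ∈ s.biUnion t, f b ≤ ∑ a ∈ s, ∑ b ∈ t a, f b := by
  classical
  induction s using Finset.induction_on with
  | empty => simp
  | insert a s ha ih =>
    rw [Finset.biUnion_insert, Finset.sum_insert ha]
    have h1 := ih fun a ha => hf a (Finset.mem_insert_of_mem ha)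
    have h2 := Finset.sum_union_inter (s₁ := t a) (s₂ := s.biUnion t) (f := f)
    have h3 : 0 ≤ ∑ b ∈ t a ∩ s.biUnion t, f b := Finset.sum_nonneg fun b hb =>
      hf a (Finset.mem_insert_self _ _) b (Finset.mem_inter.1 hb).1
    linarith

/-- Each hierarchy embeds every graph edge as a path of the universal copy tree. -/
lemma exists_edge_image {V : Type*} [DecidableEq V] {d : V → V → ℝ} {r : V} {L : ℕ}
    {c : ℕ → V → V} (hc : IsCenterHierarchy d r L c) (e : Sym2 V) :
    ∃ F : Finset (Sym2 (CenterNode d r L)),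
      (F : Set (Sym2 (CenterNode d r L))) ⊆
        (parentGraph CenterNode.root CenterNode.parent).edgeSet ∧
      (∀ u v, s(u, v) = e → EdgeConn (F : Set (Sym2 (CenterNode d r L)))
        (chainNode hc u L 0 (zero_add L)) (chainNode hc v L 0 (zero_add L))) ∧
      ∑ e ∈ F, (lowerEnd CenterNode.root CenterNode.parent e).weight ≤
        12 * ∑ j ∈ (Finset.range L).filter (fun j => c j e.out.1 ≠ c j e.out.2), (2 : ℝ) ^ j := by
  obtain ⟨F, hF, hconn, hw⟩ := exists_connecting_tree_edges hc e.out.1 e.out.2 L 0 (zero_add L)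
  refine ⟨F, hF, fun u v huv => ?_, ?_⟩
  · have hout : s(e.out.1, e.out.2) = e := Quot.out_eq e
    rcases Sym2.eq_iff.1 (huv.trans hout.symm) with ⟨rfl, rfl⟩ | ⟨rfl, rfl⟩
    · exact hconn
    · exact hconn.symm
  · have hnonneg : 0 ≤ ∑ j ∈ (Finset.range L).filter (fun j => c j e.out.1 ≠ c j e.out.2),
        (2 : ℝ) ^ j := Finset.sum_nonneg fun j _ => by positivity
    rcases hw with ⟨rfl, -⟩ | hw
    · simpa using hnonneg
    · rw [Finset.range_eq_Ico]
      simp only [pow_zero] at hw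
      linarith

lemma label_chainNode {V : Type*} {d : V → V → ℝ} {r : V} {L : ℕ}
    {c : ℕ → V → V} (hc : IsCenterHierarchy d r L c) (u : V) :
    (chainNode hc u L 0 (zero_add L)).label = u :=
  (nodeLabel_centerChain hc u L 0 (zero_add L)).trans (hc.zero u)

/-- Forward mapping of a tuple of edge sets into the universal copy tree: the distinguished
coordinate is mapped along few hierarchies, and every other one along a single hierarchy. -/
lemma exists_forward_tuple {V Ω : Type*} [DecidableEq V] [Fintype Ω] [Nonempty Ω]
    {d : V → V → ℝ} {r : V} {L m : ℕ} {c : Ω → ℕ → V → V}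
    (hc : ∀ ω, IsCenterHierarchy d r L (c ω)) (E : Set (Sym2 V)) (w : Sym2 V → ℝ) (K : ℝ)
    (hK : ∀ e ∈ E, ∑ ω, ∑ i ∈ (Finset.range L).filter (fun i => c ω i e.out.1 ≠ c ω i e.out.2),
      (2 : ℝ) ^ i ≤ Fintype.card Ω * (K * w e))
    (X : Fin (m + 1) → Finset (Sym2 V)) (hX : ∀ i, (X i : Set (Sym2 V)) ⊆ E) :
    ∃ X' : Fin (m + 1) → Finset (Sym2 (CenterNode d r L)),
      (∀ i, (X' i : Set (Sym2 (CenterNode d r L))) ⊆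
        (parentGraph CenterNode.root CenterNode.parent).edgeSet) ∧
      (∀ i, i ≠ 0 → ∀ u v, EdgeConn ((X 0 : Set (Sym2 V)) ∪ X i) u v →
        SetConn ((X' 0 : Set (Sym2 (CenterNode d r L))) ∪ X' i)
          {x | x.label = u} {x | x.label = v}) ∧
      ∃ k : ℕ, (k = 0 ∨ 2 ^ k ≤ 2 * m) ∧
        ∑ e ∈ X' 0, (lowerEnd CenterNode.root CenterNode.parent e).weight
          ≤ k * (48 * K * ∑ e ∈ X 0, w e) ∧
        ∀ i, i ≠ 0 → ∑ e ∈ X' i, (lowerEnd CenterNode.root CenterNode.parent e).weight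
          ≤ 48 * K * ∑ e ∈ X i, w e := by
  classical
  choose P hP hPconn hPw using fun ω e => exists_edge_image (hc ω) e
  set W : Finset (Sym2 (CenterNode d r L)) → ℝ := fun F =>
    ∑ e ∈ F, (lowerEnd CenterNode.root CenterNode.parent e).weight with hW
  set g : Ω → Sym2 V → ℝ := fun ω e => 12 * ∑ j ∈ (Finset.range L).filter
    (fun j => c ω j e.out.1 ≠ c ω j e.out.2), (2 : ℝ) ^ j with hg
  have hg0 : ∀ ω e, 0 ≤ g ω e := fun ω e =>
    mul_nonneg (by norm_num) (Finset.sum_nonneg fun j _ => by positivity)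
  have hgsum : ∀ Y : Finset (Sym2 V), (Y : Set (Sym2 V)) ⊆ E →
      ∑ ω, ∑ e ∈ Y, g ω e ≤ Fintype.card Ω * (12 * K * ∑ e ∈ Y, w e) := by
    intro Y hY
    rw [Finset.sum_comm, Finset.mul_sum, Finset.mul_sum]
    refine Finset.sum_le_sum fun e he => ?_
    simp only [hg]
    rw [← Finset.mul_sum]
    have := hK e (hY he)
    linarith
  have hTw : ∀ ω (Y : Finset (Sym2 V)), W (Y.biUnion (P ω)) ≤ ∑ e ∈ Y, g ω e := fun ω Y =>
    (sum_biUnion_le _ _ _ fun _ _ _ _ => CenterNode.weight_nonneg _).trans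
      (Finset.sum_le_sum fun e _ => hPw ω e)
  have hTsub : ∀ ω (Y : Finset (Sym2 V)),
      ((Y.biUnion (P ω) : Finset _) : Set (Sym2 (CenterNode d r L))) ⊆
        (parentGraph CenterNode.root CenterNode.parent).edgeSet := by
    intro ω Y e he
    obtain ⟨f, -, hf⟩ := Finset.mem_biUnion.1 he
    exact hP ω f hf
  obtain ⟨S, hS, hS0, hSi⟩ := exists_few_good_samples (ι := Fin m)
    (fun ω => ∑ e ∈ X 0, g ω e) (fun ω => Finset.sum_nonneg fun e _ => hg0 ω e) _
    (hgsum _ (hX 0))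
    (fun i ω => ∑ e ∈ X i.succ, g ω e) (fun i ω => Finset.sum_nonneg fun e _ => hg0 ω e) _
    (fun i => hgsum _ (hX i.succ))
  choose pick hpickS hpick using hSi
  refine ⟨Fin.cases (S.biUnion fun ω => (X 0).biUnion (P ω))
    (fun i => (X i.succ).biUnion (P (pick i))), ?_, ?_, S.card, ?_, ?_, ?_⟩
  · intro i
    cases i using Fin.cases with
    | zero =>
      intro e he
      obtain ⟨ω, -, hω⟩ := Finset.mem_biUnion.1 he
      exact hTsub ω (X 0) hω
    | succ i => exact hTsub _ _
  · intro i hi u v huv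
    cases i using Fin.cases with
    | zero => exact absurd rfl hi
    | succ i =>
      refine ⟨_, label_chainNode (hc (pick i)) u, _, label_chainNode (hc (pick i)) v, ?_⟩
      refine EdgeConn.map (fun u => chainNode (hc (pick i)) u L 0 (zero_add L))
        (fun a b hab => ?_) huv
      refine (hPconn (pick i) s(a, b) a b rfl).mono fun e he => ?_
      rcases hab with hab | hab
      · exact Or.inl (Finset.mem_biUnion.2 ⟨pick i, hpickS i, Finset.mem_biUnion.2 ⟨_, hab, he⟩⟩)
      · exact Or.inr (Finset.mem_biUnion.2 ⟨_, hab, he⟩)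
  · rw [Fintype.card_fin] at hS
    exact hS.imp (fun h => by rw [h, Finset.card_empty]) id
  · refine (sum_biUnion_le _ _ _ fun _ _ _ _ => CenterNode.weight_nonneg _).trans ?_
    rw [← nsmul_eq_mul]
    refine Finset.sum_le_card_nsmul _ _ _ fun ω hω => ?_
    have h1 := hTw ω (X 0)
    have h2 := hS0 ω hω
    simp only [hW] at h1
    linarith
  · intro i hi
    cases i using Fin.cases with
    | zero => exact absurd rfl hi
    | succ i =>
      have h1 := hTw (pick i) (X i.succ)
      have h2 := hpick i
      simp only [hW] at h1
      simp only [Fin.cases_succ]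
      linarith

/-- Backward mapping: replace every tree edge by a cheapest connecting edge set. -/
lemma exists_backward_map {V : Type*} (E : Set (Sym2 V)) (w : Sym2 V → ℝ)
    (hw : ∀ e ∈ E, 0 ≤ w e) (P : V → V → Finset (Sym2 V))
    (hP : ∀ u v, (P u v : Set (Sym2 V)) ⊆ E)
    (hPconn : ∀ u v, EdgeConn (P u v : Set (Sym2 V)) u v) (r : V) (L : ℕ) :
    let d : V → V → ℝ := fun u v => ∑ e ∈ P u v, w e
    ∃ B : Finset (Sym2 (CenterNode d r L)) → Finset (Sym2 V),
      (∀ Y, (B Y : Set (Sym2 V)) ⊆ E) ∧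
      (∀ Y Z : Finset (Sym2 (CenterNode d r L)),
        (Y : Set (Sym2 (CenterNode d r L))) ⊆
          (parentGraph CenterNode.root CenterNode.parent).edgeSet →
        (Z : Set (Sym2 (CenterNode d r L))) ⊆
          (parentGraph CenterNode.root CenterNode.parent).edgeSet →
        ∀ x y, EdgeConn ((Y : Set (Sym2 (CenterNode d r L))) ∪ Z) x y →
          EdgeConn ((B Y : Set (Sym2 V)) ∪ B Z) x.label y.label) ∧
      ∀ Y : Finset (Sym2 (CenterNode d r L)), (Y : Set (Sym2 (CenterNode d r L))) ⊆
          (parentGraph CenterNode.root CenterNode.parent).edgeSet →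
        ∑ e ∈ B Y, w e
          ≤ ∑ e ∈ Y, (lowerEnd CenterNode.root CenterNode.parent e).weight := by
  classical
  intro d
  set p : Sym2 (CenterNode d r L) → Finset (Sym2 V) := fun e =>
    P (lowerEnd CenterNode.root CenterNode.parent e).parent.label
      (lowerEnd CenterNode.root CenterNode.parent e).label with hp
  refine ⟨fun Y => Y.biUnion p, fun Y e he => ?_, fun Y Z hY hZ x y hxy => ?_, fun Y hY => ?_⟩
  · obtain ⟨f, -, hf⟩ := Finset.mem_biUnion.1 he
    exact hP _ _ hf
  · refine EdgeConn.map CenterNode.label (fun a b hab => ?_) hxy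
    have hmem : s(a, b) ∈ (parentGraph (CenterNode.root (d := d) (r := r) (L := L))
        CenterNode.parent).edgeSet := hab.elim (fun h => hY h) (fun h => hZ h)
    have hsub : (p s(a, b) : Set (Sym2 V)) ⊆ (Y.biUnion p : Set (Sym2 V)) ∪ Z.biUnion p := by
      intro e he
      rcases hab with hab | hab
      · exact Or.inl (Finset.mem_biUnion.2 ⟨_, hab, he⟩)
      · exact Or.inr (Finset.mem_biUnion.2 ⟨_, hab, he⟩)
    refine EdgeConn.mono hsub ?_
    rw [edgeSet_parentGraph CenterNode.depth_eq] at hmem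
    obtain ⟨z, hz, h⟩ := hmem
    have hpe : p s(a, b) = P z.parent.label z.label := by
      simp only [hp]
      rw [h, lowerEnd_parent_edge CenterNode.depth_eq hz]
    rw [hpe]
    rcases Sym2.eq_iff.1 h with ⟨rfl, rfl⟩ | ⟨rfl, rfl⟩
    · exact (hPconn _ _).symm
    · exact hPconn _ _
  · refine (sum_biUnion_le _ _ _ fun e _ f hf => hw f (hP _ _ hf)).trans
      (Finset.sum_le_sum fun e he => ?_)
    have hmem := hY he
    rw [edgeSet_parentGraph CenterNode.depth_eq] at hmem
    obtain ⟨z, hz, rfl⟩ := hmem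
    rw [lowerEnd_parent_edge CenterNode.depth_eq hz]
    exact CenterNode.dist_label_parent_le z hz

lemma sample_count_le {c : ℝ} (hc : 0 < c) {n m k : ℕ} (hn : 2 ≤ n) (hm : (m : ℝ) ≤ (n : ℝ) ^ c)
    (hk : k = 0 ∨ 2 ^ k ≤ 2 * m) : (k : ℝ) ≤ (2 + 2 * c) * Real.log n := by
  have hn' : (2 : ℝ) ≤ n := by exact_mod_cast hn
  have hlog2 := Real.log_two_gt_d9
  have hlogn : Real.log 2 ≤ Real.log n := Real.log_le_log two_pos hn'
  rcases hk with rfl | hk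
  · rw [Nat.cast_zero]
    have : 0 < Real.log n := by linarith
    positivity
  have hk' : (2 : ℝ) ^ k ≤ 2 * (n : ℝ) ^ c := by
    have : (2 : ℝ) ^ k ≤ 2 * m := by exact_mod_cast hk
    linarith
  have h := Real.log_le_log (by positivity) hk'
  rw [Real.log_pow, Real.log_mul two_ne_zero (by positivity),
    Real.log_rpow (by linarith)] at h
  have hk1 : (k : ℝ) - 1 ≤ 2 * (c * Real.log n) := by
    by_contra hcon
    push Not at hcon
    have : 0 ≤ c * Real.log n := mul_nonneg hc.le (by linarith)
    nlinarith
  linarith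

/-- For every constant `c > 0` there is a constant `C` such that every
weighted graph `G` on `n ≥ 2` vertices with edge weights at least `1`, with any root `r`
and any `m ≤ n^c`, admits a well-separated `(C·log²n)`-approximate demand-robust copy
tree embedding for tuples of length `m+1`. -/
theorem exists_demandRobust_copyTreeEmbedding :
    ∀ c : ℝ, 0 < c →
      ∃ C : ℝ, 0 < C ∧
        ∀ (V : Type) [Fintype V], ∀ (G : SimpleGraph V) (w : Sym2 V → ℝ) (r : V) (m : ℕ),
          2 ≤ Fintype.card V → G.Connected → (∀ e ∈ G.edgeSet, 1 ≤ w e) →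
          (m : ℝ) ≤ (Fintype.card V : ℝ) ^ c →
          ∃ (V' : Type) (_ : Finite V')
            (emb : DRCopyTreeEmbedding V V' G w r
              (C * Real.log (Fintype.card V : ℝ) ^ 2) m),
            WellSeparated emb.tree emb.root emb.w' := by
  intro c hc
  refine ⟨720 * (2 + 2 * c), by positivity, ?_⟩
  intro V _ G w r m hn hG hw hm
  classical
  obtain ⟨P, hP, hPconn, hmetric, hPw⟩ := exists_connecting_edges_metric G hG w hw
  have hw0 : ∀ e ∈ G.edgeSet, 0 ≤ w e := fun e he => zero_le_one.trans (hw e he)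
  let d : V → V → ℝ := fun u v => ∑ e ∈ P u v, w e
  obtain ⟨L, Ω, _, _, h, hh, hcut⟩ := exists_centerHierarchies d hmetric r
  obtain ⟨B, hB, hBconn, hBw⟩ := exists_backward_map G.edgeSet w hw0 P hP hPconn r L
  set n := Fintype.card V
  set K : ℝ := 3 * (2 + Real.log n) with hK
  have hlog : (1 : ℝ) / 2 < Real.log n := by
    have h1 := Real.log_two_gt_d9
    have h2 : Real.log 2 ≤ Real.log n := Real.log_le_log two_pos (by exact_mod_cast hn)
    linarith
  have hKle : 48 * K ≤ 720 * Real.log n := by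
    rw [hK]; linarith
  have hcutE : ∀ e ∈ G.edgeSet, ∑ ω, ∑ i ∈ (Finset.range L).filter
      (fun i => h ω i e.out.1 ≠ h ω i e.out.2), (2 : ℝ) ^ i ≤ Fintype.card Ω * (K * w e) := by
    intro e he
    have hout : s(e.out.1, e.out.2) = e := Quot.out_eq e
    have h1 := hPw e.out.1 e.out.2 (by rwa [hout])
    rw [hout] at h1
    refine (hcut e.out.1 e.out.2).trans (mul_le_mul_of_nonneg_left
      (mul_le_mul_of_nonneg_left h1 ?_) (Nat.cast_nonneg _))
    linarith
  have hfwd : ∀ X : Fin (m + 1) → Finset (Sym2 V),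
      ∃ X' : Fin (m + 1) → Finset (Sym2 (CenterNode d r L)), (∀ i, ↑(X i) ⊆ G.edgeSet) →
        (∀ i, (X' i : Set (Sym2 (CenterNode d r L))) ⊆
          (parentGraph CenterNode.root CenterNode.parent).edgeSet) ∧
        (∀ i, i ≠ 0 → ∀ u v, EdgeConn ((X 0 : Set (Sym2 V)) ∪ X i) u v →
          SetConn ((X' 0 : Set (Sym2 (CenterNode d r L))) ∪ X' i)
            {x | x.label = u} {x | x.label = v}) ∧
        ∀ i, ∑ e ∈ X' i, (lowerEnd CenterNode.root CenterNode.parent e).weight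
          ≤ 720 * (2 + 2 * c) * Real.log n ^ 2 * ∑ e ∈ X i, w e := by
    intro X
    by_cases hX : ∀ i, ↑(X i) ⊆ G.edgeSet
    · obtain ⟨X', h1, h2, k, hk, h3, h4⟩ := exists_forward_tuple hh G.edgeSet w K hcutE X hX
      refine ⟨X', fun _ => ⟨h1, h2, fun i => ?_⟩⟩
      have hk' := sample_count_le hc hn hm hk
      have hX0 : 0 ≤ ∑ e ∈ X i, w e := Finset.sum_nonneg fun e he => hw0 e (hX i he)
      by_cases hi : i = 0
      · subst hi
        calc _ ≤ k * (48 * K * ∑ e ∈ X 0, w e) := h3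
          _ ≤ ((2 + 2 * c) * Real.log n) * (720 * Real.log n * ∑ e ∈ X 0, w e) := by
            gcongr
          _ = _ := by ring
      · refine (h4 i hi).trans (mul_le_mul_of_nonneg_right (hKle.trans ?_) hX0)
        nlinarith [mul_pos hc (show 0 < Real.log n by linarith)]
    · exact ⟨fun _ => ∅, fun h => absurd h hX⟩
  choose A hA using hfwd
  have hroot := CenterNode.depth_root (d := d) (r := r) (L := L)
  have hdepth := CenterNode.depth_eq (d := d) (r := r) (L := L)
  refine ⟨CenterNode d r L, inferInstance, {
    tree := parentGraph CenterNode.root CenterNode.parent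
    isTree := isTree_parentGraph hroot hdepth
    w' := fun e => (lowerEnd CenterNode.root CenterNode.parent e).weight
    root := CenterNode.root
    copies := fun v => {x | x.label = v}
    copies_nonempty := fun v =>
      ⟨_, label_chainNode (hh (Classical.arbitrary Ω)) v⟩
    copies_disjoint := fun u v huv => Set.disjoint_left.2 fun x hu hv => huv (hu.symm.trans hv)
    copies_cover := fun x => ⟨x.label, rfl⟩
    copies_root := Set.ext fun x => x.label_eq_iff
    mapGT := A
    mapTG := fun X' i => B (X' i)
    mapGT_sub := fun X hX => (hA X hX).1
    mapTG_sub := fun X' _ i => hB (X' i)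
    conn_GT := fun X hX => (hA X hX).2.1
    cost_GT := fun X hX => (hA X hX).2.2
    conn_TG := ?_
    cost_TG := fun X' hX' i => hBw _ (hX' i) },
    wellSeparated_parentGraph hroot hdepth CenterNode.weight CenterNode.weight_le_half⟩
  rintro X' hX' i - _ _ x y rfl rfl hxy
  exact hBconn _ _ (hX' 0) (hX' i) x y hxy
end

section
/- Let F be a finite tree with nonnegative edge weights and let V' be a set of vertices of F containing all leaves of F. Then the multigraph obtained by doubling every edge of F can be partitioned into edge-disjoint paths, each of which has both endpoints in V', and the total weight of these paths equals 2·w(F), where w(F) is the total edge weight of F. -/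
namespace SimpleGraph

variable {V : Type*} {G : SimpleGraph V}

/-- The edges traversed by a family of walks, counted with multiplicity. -/
def walkEdges (P : Multiset ((u : V) × (v : V) × G.Walk u v)) : Multiset (Sym2 V) :=
  (P.map fun p => (↑p.2.2.edges : Multiset (Sym2 V))).sum

@[simp]
lemma walkEdges_cons (p : (u : V) × (v : V) × G.Walk u v)
    (P : Multiset ((u : V) × (v : V) × G.Walk u v)) :
    walkEdges (p ::ₘ P) = ↑p.2.2.edges + walkEdges P := by
  simp [walkEdges]

lemma mem_walkEdges {P : Multiset ((u : V) × (v : V) × G.Walk u v)} {e : Sym2 V} :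
    e ∈ walkEdges P ↔ ∃ p ∈ P, e ∈ p.2.2.edges := by
  induction P using Multiset.induction_on with
  | empty => simp [walkEdges]
  | cons p P ih => simp only [walkEdges_cons, Multiset.mem_add, ih, Multiset.mem_cons]; simp

lemma Walk.exists_adj_mem_edges {u v x : V} {p : G.Walk u v} (hp : ¬ p.Nil) (hx : x ∈ p.support) :
    ∃ y, G.Adj x y ∧ s(x, y) ∈ p.edges := by
  obtain ⟨e, he, hxe⟩ := (Walk.mem_support_iff_exists_mem_edges_of_not_nil hp).1 hx
  obtain ⟨y, rfl⟩ := hxe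
  exact ⟨y, p.adj_of_mem_edges he, he⟩

/-- A path meeting a vertex with a unique neighbour starts or ends there. -/
lemma Walk.IsPath.eq_or_eq_of_existsUnique_adj {u v x : V} {p : G.Walk u v} (hp : p.IsPath)
    (hx : x ∈ p.support) (hl : ∃! y, G.Adj x y) : u = x ∨ v = x := by
  by_contra! h
  obtain ⟨q, r, rfl⟩ := Walk.mem_support_iff_exists_append.1 hx
  obtain ⟨y, hy, hyq⟩ := Walk.exists_adj_mem_edges (Walk.not_nil_of_ne h.1) q.end_mem_support
  obtain ⟨z, hz, hzr⟩ := Walk.exists_adj_mem_edges (Walk.not_nil_of_ne h.2.symm) r.start_mem_support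
  obtain rfl := hl.unique hy hz
  have := hp.isTrail.edges_nodup
  rw [Walk.edges_append] at this
  exact List.disjoint_of_nodup_append this hyq hzr

/-- A nontrivial path meeting a vertex with a unique neighbour can be oriented to start there. -/
lemma Walk.IsPath.exists_oriented_of_existsUnique_adj {u v x : V} {p : G.Walk u v} (hp : p.IsPath)
    (hnil : ¬ p.Nil) (hx : x ∈ p.support) (hl : ∃! y, G.Adj x y) :
    ∃ (y : V) (q : G.Walk x y), q.IsPath ∧ y ≠ x ∧ (y = u ∨ y = v) ∧
      (q.edges : Multiset (Sym2 V)) = p.edges := by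
  have hne : u ≠ v := fun h => hnil (hp.nil_iff_eq.2 h)
  obtain rfl | rfl := hp.eq_or_eq_of_existsUnique_adj hx hl
  · exact ⟨v, p, hp, hne.symm, .inr rfl, rfl⟩
  · exact ⟨u, p.reverse, hp.reverse, hne, .inl rfl, by simp⟩

lemma walkEdges_map_mapLe {H : SimpleGraph V} (h : H ≤ G)
    (P : Multiset ((u : V) × (v : V) × H.Walk u v)) :
    walkEdges (P.map fun p => (⟨p.1, p.2.1, p.2.2.mapLe h⟩ : (u : V) × (v : V) × G.Walk u v)) =
      walkEdges P := by
  simp only [walkEdges, Multiset.map_map, Function.comp_def, Walk.edges_mapLe_eq_edges]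

/-- A finite forest with at least one edge has a leaf. -/
lemma IsAcyclic.exists_existsUnique_adj [Finite V] (h : G.IsAcyclic) (hne : G ≠ ⊥) :
    ∃ l, ∃! x, G.Adj l x := by
  obtain ⟨a, b, hab⟩ := ne_bot_iff_exists_adj.1 hne
  have : Nonempty V := ⟨a⟩
  have ⟨u, v, p, hp, hmax⟩ := Walk.exists_isPath_forall_isPath_length_le_length G
  have hnil : ¬ p.Nil := by
    rw [Walk.not_nil_iff_lt_length]
    exact hmax a b (.cons hab .nil) (by simp [hab.ne])
  refine ⟨u, p.snd, p.adj_snd hnil, fun w hadj => h.eq_snd_of_adj_start hp hadj ?_⟩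
  by_contra hw
  have := hmax _ _ (p.cons hadj.symm) (hp.cons hw)
  simp at this

variable [DecidableEq V]

lemma count_walkEdges_eq_zero {P : Multiset ((u : V) × (v : V) × G.Walk u v)} {e : Sym2 V}
    (he : e ∉ G.edgeSet) : (walkEdges P).count e = 0 := by
  rw [Multiset.count_eq_zero, mem_walkEdges]
  rintro ⟨p, -, hp⟩
  exact he (p.2.2.edges_subset_edgeSet hp)

/-- A family of nontrivial paths joining vertices of degree one and covering every edge twice. -/
structure IsDoubleLeafPathCover (P : Multiset ((u : V) × (v : V) × G.Walk u v)) : Prop where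
  isPath : ∀ p ∈ P, p.2.2.IsPath
  not_nil : ∀ p ∈ P, ¬ p.2.2.Nil
  fst_leaf : ∀ p ∈ P, ∃! x, G.Adj p.1 x
  snd_leaf : ∀ p ∈ P, ∃! x, G.Adj p.2.1 x
  count_eq : ∀ e ∈ G.edgeSet, (walkEdges P).count e = 2

/-- A double cover by paths between leaves can be opened up at any vertex `x`, so that exactly two
of the paths start at `x`. -/
lemma IsDoubleLeafPathCover.exists_open {P : Multiset ((u : V) × (v : V) × G.Walk u v)}
    (hP : IsDoubleLeafPathCover P) (x : V) :
    ∃ (R : Multiset ((u : V) × (v : V) × G.Walk u v)) (y z : V) (c : G.Walk x y) (d : G.Walk x z),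
      c.IsPath ∧ d.IsPath ∧
      ((y ≠ x ∧ ∃! t, G.Adj y t) ∨ (y = x ∧ ∀ t, ¬ G.Adj x t)) ∧
      ((z ≠ x ∧ ∃! t, G.Adj z t) ∨ (z = x ∧ ∀ t, ¬ G.Adj x t)) ∧
      (∀ p ∈ R, p.2.2.IsPath) ∧ (∀ p ∈ R, ¬ p.2.2.Nil) ∧
      (∀ p ∈ R, p.1 ≠ x ∧ ∃! t, G.Adj p.1 t) ∧ (∀ p ∈ R, p.2.1 ≠ x ∧ ∃! t, G.Adj p.2.1 t) ∧
      walkEdges P = ↑c.edges + ↑d.edges + walkEdges R := by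
  by_cases h0 : ∃ t, G.Adj x t
  · obtain ⟨t, ht⟩ := h0
    have hc := hP.count_eq s(x, t) ht
    obtain ⟨a, haP, ha⟩ := mem_walkEdges.1 (Multiset.count_pos.1 (by rw [hc]; norm_num))
    obtain ⟨Q, rfl⟩ := Multiset.exists_cons_of_mem haP
    have hxa := a.2.2.fst_mem_support_of_mem_edges ha
    by_cases hl : ∃! t, G.Adj x t
    · have ha1 := (hP.isPath a haP).isTrail.count_edges_eq_one ha
      have hc' : (walkEdges Q).count s(x, t) = 1 := by
        rw [walkEdges_cons, Multiset.count_add, Multiset.coe_count, ha1] at hc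
        omega
      obtain ⟨b, hbQ, hb⟩ := mem_walkEdges.1 (Multiset.count_pos.1 (by rw [hc']; norm_num))
      obtain ⟨R, rfl⟩ := Multiset.exists_cons_of_mem hbQ
      have hbP : b ∈ a ::ₘ b ::ₘ R := by simp
      have hxb := b.2.2.fst_mem_support_of_mem_edges hb
      have hb1 := (hP.isPath b hbP).isTrail.count_edges_eq_one hb
      have hR : s(x, t) ∉ walkEdges R := by
        rw [walkEdges_cons, Multiset.count_add, Multiset.coe_count, hb1] at hc'
        exact Multiset.count_eq_zero.1 (by omega)
      have hRP : ∀ p ∈ R, p ∈ a ::ₘ b ::ₘ R := fun p hp => by simp [hp]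
      have hRx : ∀ p ∈ R, x ∉ p.2.2.support := by
        intro p hp hx
        obtain ⟨s, hs, hsp⟩ := Walk.exists_adj_mem_edges (hP.not_nil p (hRP p hp)) hx
        obtain rfl := hl.unique hs ht
        exact hR (mem_walkEdges.2 ⟨p, hp, hsp⟩)
      obtain ⟨y, c, hcp, hyx, hy, hca⟩ :=
        (hP.isPath a haP).exists_oriented_of_existsUnique_adj (hP.not_nil a haP) hxa hl
      obtain ⟨z, d, hdp, hzx, hz, hdb⟩ :=
        (hP.isPath b hbP).exists_oriented_of_existsUnique_adj (hP.not_nil b hbP) hxb hl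
      refine ⟨R, y, z, c, d, hcp, hdp, .inl ⟨hyx, ?_⟩, .inl ⟨hzx, ?_⟩,
        fun p hp => hP.isPath p (hRP p hp), fun p hp => hP.not_nil p (hRP p hp),
        fun p hp => ⟨?_, hP.fst_leaf p (hRP p hp)⟩, fun p hp => ⟨?_, hP.snd_leaf p (hRP p hp)⟩, ?_⟩
      · rcases hy with rfl | rfl
        exacts [hP.fst_leaf a haP, hP.snd_leaf a haP]
      · rcases hz with rfl | rfl
        exacts [hP.fst_leaf b hbP, hP.snd_leaf b hbP]
      · rintro rfl
        exact hRx p hp p.2.2.start_mem_support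
      · rintro rfl
        exact hRx p hp p.2.2.end_mem_support
      · rw [walkEdges_cons, walkEdges_cons, hca, hdb, add_assoc]
    · have hQP : ∀ p ∈ Q, p ∈ a ::ₘ Q := fun p hp => Multiset.mem_cons_of_mem hp
      have hne : ∀ y, (∃! t, G.Adj y t) → y ≠ x := by
        rintro y hy rfl
        exact hl hy
      obtain ⟨q, r, hqr⟩ := Walk.mem_support_iff_exists_append.1 hxa
      have hu := hP.fst_leaf _ haP
      have hv := hP.snd_leaf _ haP
      have hp := hP.isPath _ haP
      rw [hqr] at hp
      exact ⟨Q, a.1, a.2.1, q.reverse, r, hp.of_append_left.reverse, hp.of_append_right,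
        .inl ⟨hne _ hu, hu⟩, .inl ⟨hne _ hv, hv⟩,
        fun p hp => hP.isPath p (hQP p hp), fun p hp => hP.not_nil p (hQP p hp),
        fun p hp => ⟨hne _ (hP.fst_leaf p (hQP p hp)), hP.fst_leaf p (hQP p hp)⟩,
        fun p hp => ⟨hne _ (hP.snd_leaf p (hQP p hp)), hP.snd_leaf p (hQP p hp)⟩, by
          rw [walkEdges_cons, hqr]
          simp [← Multiset.coe_add]⟩
  · push Not at h0
    have hne : ∀ y, (∃! t, G.Adj y t) → y ≠ x := by
      rintro y ⟨t, ht, -⟩ rfl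
      exact h0 t ht
    exact ⟨P, x, x, .nil, .nil, .nil, .nil, .inr ⟨rfl, h0⟩, .inr ⟨rfl, h0⟩, hP.isPath, hP.not_nil,
      fun p hp => ⟨hne _ (hP.fst_leaf p hp), hP.fst_leaf p hp⟩,
      fun p hp => ⟨hne _ (hP.snd_leaf p hp), hP.snd_leaf p hp⟩, by simp⟩

/-- Attaching a pendant edge preserves the existence of a double cover by paths between leaves. -/
lemma IsDoubleLeafPathCover.exists_of_deleteEdges {H : SimpleGraph V} {l x : V} (hlx : G.Adj l x)
    (hl : ∀ t, G.Adj l t → t = x)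
    (hH : H = G.deleteEdges {s(l, x)}) {P : Multiset ((u : V) × (v : V) × H.Walk u v)}
    (hP : IsDoubleLeafPathCover P) :
    ∃ Q : Multiset ((u : V) × (v : V) × G.Walk u v), IsDoubleLeafPathCover Q := by
  obtain ⟨R, y, z, c, d, hc, hd, hy, hz, hRp, hRn, hR1, hR2, hE⟩ := hP.exists_open x
  have hle : H ≤ G := hH ▸ deleteEdges_le _
  have hadj : ∀ a b, H.Adj a b ↔ G.Adj a b ∧ s(a, b) ≠ s(l, x) := by
    intro a b; simp [hH]
  have hlH : ∀ t, ¬ H.Adj l t := by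
    intro t ht
    obtain ⟨h1, h2⟩ := (hadj l t).1 ht
    exact h2 (by rw [hl t h1])
  have hleaf : ∀ v, v ≠ x ∧ (∃! t, H.Adj v t) → ∃! t, G.Adj v t := by
    rintro v ⟨hvx, t, ht, htu⟩
    refine ⟨t, hle ht, fun s hs => htu s ((hadj v s).2 ⟨hs, fun he => ?_⟩)⟩
    rcases Sym2.eq_iff.1 he with ⟨rfl, -⟩ | ⟨rfl, -⟩
    · exact hlH t ht
    · exact hvx rfl
  have hleaf' : ∀ v, (v ≠ x ∧ ∃! t, H.Adj v t) ∨ (v = x ∧ ∀ t, ¬ H.Adj x t) →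
      ∃! t, G.Adj v t := by
    rintro v (h | ⟨rfl, h⟩)
    · exact hleaf v h
    · refine ⟨l, hlx.symm, fun s hs => ?_⟩
      by_contra hsl
      refine h s ((hadj v s).2 ⟨hs, fun he => ?_⟩)
      rcases Sym2.eq_iff.1 he with ⟨rfl, h2⟩ | ⟨-, h2⟩
      · exact hlx.ne rfl
      · exact hsl h2
  have hll : ∃! t, G.Adj l t := ⟨x, hlx, hl⟩
  have hsupp : ∀ v (p : H.Walk x v), l ∉ p.support := by
    intro v p hp
    by_cases hn : p.Nil
    · rw [Walk.nil_iff_support_eq.1 hn] at hp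
      exact hlx.ne (by simpa using hp)
    · obtain ⟨t, ht, -⟩ := Walk.exists_adj_mem_edges hn hp
      exact hlH t ht
  refine ⟨⟨l, y, .cons hlx (c.mapLe hle)⟩ ::ₘ ⟨l, z, .cons hlx (d.mapLe hle)⟩ ::ₘ
    R.map fun p => ⟨p.1, p.2.1, p.2.2.mapLe hle⟩, ?_, ?_, ?_, ?_, ?_⟩
  · simp only [Multiset.forall_mem_cons, Multiset.forall_mem_map_iff, Walk.cons_isPath_iff,
      Walk.isPath_mapLe, Walk.support_mapLe_eq_support]
    exact ⟨⟨hc, hsupp _ c⟩, ⟨hd, hsupp _ d⟩, hRp⟩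
  · simp only [Multiset.forall_mem_cons, Multiset.forall_mem_map_iff, Walk.not_nil_iff_lt_length, Walk.length_mapLe]
    exact ⟨by simp, by simp, fun p hp => Walk.not_nil_iff_lt_length.1 (hRn p hp)⟩
  · simp only [Multiset.forall_mem_cons, Multiset.forall_mem_map_iff]
    exact ⟨hll, hll, fun p hp => hleaf _ (hR1 p hp)⟩
  · simp only [Multiset.forall_mem_cons, Multiset.forall_mem_map_iff]
    exact ⟨hleaf' _ hy, hleaf' _ hz, fun p hp => hleaf _ (hR2 p hp)⟩
  · intro e he
    have key : ∀ n, (walkEdges P).count e = n →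
        c.edges.count e + d.edges.count e + (walkEdges R).count e = n := by
      rintro n rfl
      simp [hE]
    simp only [walkEdges_cons, walkEdges_map_mapLe, Multiset.count_add, Multiset.coe_count,
      Walk.edges_cons, Walk.edges_mapLe_eq_edges, List.count_cons]
    by_cases hex : e = s(l, x)
    · have := key 0 (count_walkEdges_eq_zero (by simp [hH, hex]))
      simp only [hex, beq_self_eq_true, if_true] at this ⊢
      omega
    · have := key 2 (hP.count_eq e (by simp [hH, he, hex]))
      have hne : (s(l, x) == e) = false := by simpa using Ne.symm hex
      simp only [hne, Bool.false_eq_true, if_false]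
      omega

/-- Every finite forest has a double cover by paths between leaves. -/
lemma IsAcyclic.exists_isDoubleLeafPathCover [Finite V] (h : G.IsAcyclic) :
    ∃ P : Multiset ((u : V) × (v : V) × G.Walk u v), IsDoubleLeafPathCover P := by
  induction hn : G.edgeSet.ncard generalizing G with
  | zero =>
    have hG : G.edgeSet = ∅ := (Set.ncard_eq_zero).1 hn
    exact ⟨0, by simp, by simp, by simp, by simp, by simp [hG]⟩
  | succ n ih =>
    obtain ⟨l, x, hlx, hl⟩ := h.exists_existsUnique_adj (by
      rintro rfl
      simp at hn)
    obtain ⟨P, hP⟩ := ih (h.anti (G.deleteEdges_le {s(l, x)})) (by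
      rw [edgeSet_deleteEdges, Set.ncard_sdiff_singleton_of_mem (G.mem_edgeSet.2 hlx), hn, Nat.add_sub_cancel])
    exact hP.exists_of_deleteEdges hlx hl rfl

end SimpleGraph


/-- Let `F` be a finite tree with nonnegative edge weights and let `V'`
be a set of vertices containing all leaves of `F`.  Then the multigraph obtained by
doubling every edge of `F` can be partitioned into edge-disjoint paths, each with both
endpoints in `V'`: formally, there is a list of paths in `F` (walks that do not repeat
vertices), each with both endpoints in `V'`, whose edges taken together with multiplicity
are exactly every edge of `F` twice; consequently the total weight of these paths equals
`2·w(F)`. -/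
theorem doubled_tree_path_partition {V : Type} [Fintype V] [DecidableEq V]
    (F : SimpleGraph V) [DecidableRel F.Adj] (hF : F.IsTree)
    (w : Sym2 V → ℝ) (hw : ∀ e ∈ F.edgeSet, 0 ≤ w e)
    (V' : Set V) (hV' : ∀ v : V, F.degree v = 1 → v ∈ V') :
    ∃ P : List ((u : V) × (v : V) × F.Walk u v),
      (∀ p ∈ P, p.2.2.IsPath ∧ p.1 ∈ V' ∧ p.2.1 ∈ V') ∧
      (P.map fun p => (↑p.2.2.edges : Multiset (Sym2 V))).sum
        = F.edgeFinset.val + F.edgeFinset.val ∧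
      (P.map fun p => (p.2.2.edges.map w).sum).sum = 2 * ∑ e ∈ F.edgeFinset, w e := by
  obtain ⟨P, hP⟩ := hF.isAcyclic.exists_isDoubleLeafPathCover
  have hedges : (P.toList.map fun p => (↑p.2.2.edges : Multiset (Sym2 V))).sum
      = F.edgeFinset.val + F.edgeFinset.val := by
    have hsum : (P.toList.map fun p => (↑p.2.2.edges : Multiset (Sym2 V))).sum
        = SimpleGraph.walkEdges P := by
      rw [← Multiset.sum_coe, ← Multiset.map_coe, Multiset.coe_toList, SimpleGraph.walkEdges]
    rw [hsum]
    ext e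
    rw [Multiset.count_add]
    by_cases he : e ∈ F.edgeSet
    · rw [hP.count_eq e he, Multiset.count_eq_one_of_mem F.edgeFinset.nodup (by simpa using he)]
    · rw [SimpleGraph.count_walkEdges_eq_zero he,
        Multiset.count_eq_zero_of_notMem (by simpa using he)]
  refine ⟨P.toList, fun p hp => ?_, hedges, ?_⟩
  · rw [Multiset.mem_toList] at hp
    exact ⟨hP.isPath p hp,
      hV' _ (SimpleGraph.degree_eq_one_iff_existsUnique_adj.2 (hP.fst_leaf p hp)),
      hV' _ (SimpleGraph.degree_eq_one_iff_existsUnique_adj.2 (hP.snd_leaf p hp))⟩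
  · have hw2 := congrArg (fun M : Multiset (Sym2 V) => (M.map w).sum) hedges
    have hlist : ∀ L : List ((u : V) × (v : V) × F.Walk u v),
        (((L.map fun p => (↑p.2.2.edges : Multiset (Sym2 V))).sum).map w).sum =
          (L.map fun p => (p.2.2.edges.map w).sum).sum := by
      intro L
      induction L with
      | nil => simp
      | cons p L ih => simp [ih]
    rw [← hlist]
    refine hw2.trans ?_
    rw [Multiset.map_add, Multiset.sum_add, two_mul]
    rfl
end
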